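/- arXiv:1405.6280 — 2 statements merged into one kernel-verified Lean document; each statement's English description precedes it below -/
import Mathlib

section
/- For d = −1 and for d = −3, the Bianchi group B_d = PSL(2, O_d) has a normal non-congruence subgroup of finite index. -/
set_option linter.unusedSectionVars false

open NumberField Matrix

instance : Fact (Even (Fintype.card (Fin 2))) := ⟨⟨1, rfl⟩⟩

variable (K : Type*) [Field K] [NumberField K]

/-- The subgroup `{±I}` of `SL(2, 𝓞)`, generated by `-I`. -/
def PM : Subgroup (Matrix.SpecialLinearGroup (Fin 2) (𝓞 K)) :=
  Subgroup.closure {(-1 : Matrix.SpecialLinearGroup (Fin 2) (𝓞 K))}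

theorem PM_le_center : PM K ≤ Subgroup.center (Matrix.SpecialLinearGroup (Fin 2) (𝓞 K)) := by
  rw [PM, Subgroup.closure_le]
  rintro x rfl
  rw [SetLike.mem_coe, Subgroup.mem_center_iff]
  intro g
  ext i j
  simp [Matrix.SpecialLinearGroup.coe_mul]

instance PM_normal : (PM K).Normal := by
  constructor
  intro n hn g
  have hc := PM_le_center K hn
  rw [Subgroup.mem_center_iff] at hc
  rw [hc g, mul_assoc, mul_inv_cancel, mul_one]
  exact hn

/-- `PSL(2, 𝓞)`, the quotient of `SL(2, 𝓞)` by `{±I}`. -/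
def PSL := Matrix.SpecialLinearGroup (Fin 2) (𝓞 K) ⧸ PM K

instance : Group (PSL K) := QuotientGroup.Quotient.group (PM K)

/-- The projection `SL(2, 𝓞) → PSL(2, 𝓞)`. -/
def proj : Matrix.SpecialLinearGroup (Fin 2) (𝓞 K) →* PSL K :=
  QuotientGroup.mk' (PM K)

/-- The elementary matrix `T_x = [[1, x], [0, 1]]` in `SL(2, 𝓞)`. -/
def T (x : 𝓞 K) : Matrix.SpecialLinearGroup (Fin 2) (𝓞 K) :=
  ⟨!![1, x; 0, 1], by simp [Matrix.det_fin_two_of]⟩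

/-- The reduction homomorphism `SL(2, 𝓞) → SL(2, 𝓞/π)`. -/
def red (π : Ideal (𝓞 K)) :
    Matrix.SpecialLinearGroup (Fin 2) (𝓞 K) →*
      Matrix.SpecialLinearGroup (Fin 2) ((𝓞 K) ⧸ π) :=
  Matrix.SpecialLinearGroup.map (Ideal.Quotient.mk π)

/-- The principal congruence subgroup `Ḡ(π)` of `PSL(2,𝓞)` : the image in `PSL(2,𝓞)` of
`{A ∈ SL(2,𝓞) : A ≡ ±I (mod π)}`, the set of matrices reducing to `±I` modulo `π`. -/
def Gbar (π : Ideal (𝓞 K)) : Subgroup (PSL K) :=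
  Subgroup.map (proj K)
    (Subgroup.comap (red K π)
      (Subgroup.closure {(-1 : Matrix.SpecialLinearGroup (Fin 2) ((𝓞 K) ⧸ π))}))

/-- A subgroup of `G = PSL(2,𝓞)` is a congruence subgroup if it contains `Ḡ(π)` for some
nonzero ideal `π` of `𝓞`. -/
def IsCongruence (H : Subgroup (PSL K)) : Prop :=
  ∃ π : Ideal (𝓞 K), π ≠ ⊥ ∧ Gbar K π ≤ H

/-- The normal closure in `PSL(2,𝓞)` of the images of the matrices `T_{mx}`, `x ∈ 𝓞`. -/
def TclosureP (m : ℕ) : Subgroup (PSL K) :=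
  Subgroup.normalClosure {x : PSL K | ∃ a : 𝓞 K, x = proj K (T K ((m : 𝓞 K) * a))}

/-- `H ≤ PSL(2,𝓞)` has level `m` : `m` is the smallest positive integer such that the
normal closure in `PSL(2,𝓞)` of the images of `{T_{mx} : x ∈ 𝓞}` is contained in `H`. -/
def HasLevelP (H : Subgroup (PSL K)) (m : ℕ) : Prop :=
  0 < m ∧ TclosureP K m ≤ H ∧ ∀ k : ℕ, 0 < k → TclosureP K k ≤ H → m ≤ k

namespace BianchiPresentation

/-- A norm on a commutative ring for which division with remainder is possible, and for which any
two quotients of the same division are linked by a chain of unit steps. -/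
structure UnitChainNorm (R : Type*) [CommRing R] where
  /-- The underlying function. -/
  N : R → ℕ
  map_mul : ∀ x y, N (x * y) = N x * N y
  eq_zero_iff : ∀ x, N x = 0 ↔ x = 0
  exists_quotient : ∀ a c, c ≠ 0 → ∃ q, N (q * c - a) < N c
  exists_unit_quotient : ∀ a c, c ≠ 0 → N a = N c → ∃ u, IsUnit u ∧ N (u * c - a) < N c
  chain : ∀ x c q, N x < N c → N (x + q * c) < N c →
    q = 0 ∨ IsUnit q ∨ ∃ u v, IsUnit u ∧ IsUnit v ∧ q = u + v ∧ N (x + u * c) < N c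

/-- Elements of a group satisfying the relations between the elementary and diagonal matrices
of `PSL(2, R)`. -/
structure ElementaryRelations (R G : Type*) [CommRing R] [Group G] where
  /-- The image of `[[1, x], [0, 1]]`. -/
  τ : R → G
  /-- The image of `[[0, -1], [1, 0]]`. -/
  σ : G
  /-- The image of `[[ε, 0], [0, ε⁻¹]]`. -/
  δ : R → G
  τ_add : ∀ x y, τ (x + y) = τ x * τ y
  σ_mul_self : σ * σ = 1
  δ_neg_one : δ (-1) = 1
  δ_mul : ∀ u u' v v', u * u' = 1 → v * v' = 1 → δ (u * v) = δ u * δ v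
  δ_mul_τ : ∀ u u' x, u * u' = 1 → δ u * τ x = τ (u ^ 2 * x) * δ u
  σ_mul_δ : ∀ u u', u * u' = 1 → σ * δ u = δ u' * σ
  σ_mul_τ_mul_σ : ∀ u u', u * u' = 1 → σ * τ u * σ = τ (-u') * δ u' * σ * τ (-u')

namespace UnitChainNorm

variable {R : Type*} [CommRing R] (V : UnitChainNorm R)

theorem map_unit [Nontrivial R] {u u' : R} (h : u * u' = 1) :
    V.N u = 1 := by
  have h₁ := V.map_mul 1 1
  have h₂ := (V.eq_zero_iff 1).not.2 one_ne_zero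
  have h₃ : V.N 1 = 1 := by
    rw [mul_one] at h₁
    exact (Nat.mul_eq_left h₂).1 h₁.symm
  exact Nat.eq_one_of_mul_eq_one_right (by rw [← V.map_mul, h, h₃])

theorem map_neg [Nontrivial R] (x : R) :
    V.N (-x) = V.N x := by
  rw [← neg_one_mul, V.map_mul, V.map_unit (u := -1) (u' := -1) (by ring), one_mul]

include V

theorem isDomain [Nontrivial R] : IsDomain R :=
  have : NoZeroDivisors R := ⟨fun {x y} h => by
    rwa [← V.eq_zero_iff, V.map_mul, Nat.mul_eq_zero, V.eq_zero_iff, V.eq_zero_iff] at h⟩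
  NoZeroDivisors.to_isDomain R

theorem isPrincipalIdealRing : IsPrincipalIdealRing R where
  principal S := by
    by_cases hS : S = ⊥
    · exact hS ▸ bot_isPrincipal
    · obtain ⟨c₀, hc₀, hc₀'⟩ := S.exists_mem_ne_zero_of_ne_bot hS
      have hne : {c | c ∈ S ∧ c ≠ 0}.Nonempty := ⟨c₀, hc₀, hc₀'⟩
      obtain ⟨c, ⟨hcS, hc⟩, hmin⟩ : ∃ c, (c ∈ S ∧ c ≠ 0) ∧ ∀ x, x ∈ S ∧ x ≠ 0 → V.N c ≤ V.N x :=
        ⟨_, Function.argminOn_mem V.N _ hne, fun _ hx => Function.argminOn_le V.N _ hx⟩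
      refine ⟨c, le_antisymm (fun a ha => ?_) ((Submodule.span_singleton_le_iff_mem c S).2 hcS)⟩
      obtain ⟨q, hq⟩ := V.exists_quotient a c hc
      have h : q * c - a = 0 := by
        by_contra h
        exact hq.not_ge (hmin _ ⟨S.sub_mem (S.mul_mem_left q hcS) ha, h⟩)
      rw [← sub_eq_zero.1 h]
      exact Ideal.mul_mem_left _ q (Ideal.mem_span_singleton_self c)

end UnitChainNorm

section Matrices

variable {R : Type*} [CommRing R]

/-- The unipotent matrix `[[1, x], [0, 1]]`. -/
def upper (x : R) : SpecialLinearGroup (Fin 2) R := ⟨!![1, x; 0, 1], by simp [det_fin_two_of]⟩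

/-- The matrix `[[0, -1], [1, 0]]`. -/
def weyl : SpecialLinearGroup (Fin 2) R := ⟨!![0, -1; 1, 0], by simp [det_fin_two_of]⟩

/-- The unipotent matrix `[[1, 0], [x, 1]]`. -/
def lower (x : R) : SpecialLinearGroup (Fin 2) R := ⟨!![1, 0; x, 1], by simp [det_fin_two_of]⟩

/-- The diagonal matrix `[[u, 0], [0, u']]`, where `u * u' = 1`. -/
def diag (u u' : R) (h : u * u' = 1) : SpecialLinearGroup (Fin 2) R :=
  ⟨!![u, 0; 0, u'], by simp [det_fin_two_of, h]⟩

/-- The matrix `weyl⁻¹ * upper (-q) * M`. -/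
def step (q : R) (M : SpecialLinearGroup (Fin 2) R) : SpecialLinearGroup (Fin 2) R :=
  ⟨!![M 1 0, M 1 1; q * M 1 0 - M 0 0, q * M 1 1 - M 0 1], by
    have h := M.det_coe
    rw [det_fin_two] at h
    rw [det_fin_two_of]
    linear_combination h⟩

theorem det_eq (M : SpecialLinearGroup (Fin 2) R) : M 0 0 * M 1 1 - M 0 1 * M 1 0 = 1 := by
  have h := M.det_coe
  rwa [det_fin_two] at h

theorem ext_entries {A B : SpecialLinearGroup (Fin 2) R} (h₀₀ : A 0 0 = B 0 0)
    (h₀₁ : A 0 1 = B 0 1) (h₁₀ : A 1 0 = B 1 0) (h₁₁ : A 1 1 = B 1 1) : A = B := by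
  ext i j
  fin_cases i <;> fin_cases j <;> assumption

@[simp] theorem coe_upper (x : R) : (upper x : Matrix (Fin 2) (Fin 2) R) = !![1, x; 0, 1] := rfl

@[simp] theorem coe_lower (x : R) : (lower x : Matrix (Fin 2) (Fin 2) R) = !![1, 0; x, 1] := rfl

@[simp] theorem coe_weyl :
    ((weyl : SpecialLinearGroup (Fin 2) R) : Matrix (Fin 2) (Fin 2) R) = !![0, -1; 1, 0] := rfl

@[simp] theorem coe_diag (u u' : R) (h : u * u' = 1) :
    (diag u u' h : Matrix (Fin 2) (Fin 2) R) = !![u, 0; 0, u'] := rfl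

@[simp] theorem coe_step (q : R) (M : SpecialLinearGroup (Fin 2) R) :
    (step q M : Matrix (Fin 2) (Fin 2) R) =
      !![M 1 0, M 1 1; q * M 1 0 - M 0 0, q * M 1 1 - M 0 1] := rfl

theorem upper_mul_weyl_mul_step (q : R) (M : SpecialLinearGroup (Fin 2) R) :
    upper q * (weyl * step q M) = M := by
  apply ext_entries <;> simp [mul_apply]

theorem upper_mul_diag {M : SpecialLinearGroup (Fin 2) R} (hM : M 1 0 = 0)
    (h : M 0 0 * M 1 1 = 1) : upper (M 0 1 * M 0 0) * diag (M 0 0) (M 1 1) h = M := by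
  apply ext_entries <;> simp [hM, mul_apply]
  linear_combination (M 0 1) * h

theorem mul_eq_one_of_10_eq_zero {M : SpecialLinearGroup (Fin 2) R} (hM : M 1 0 = 0) :
    M 0 0 * M 1 1 = 1 := by
  have := det_eq M
  rwa [hM, mul_zero, sub_zero] at this

end Matrices

namespace ElementaryRelations

variable {R G : Type*} [CommRing R] [Group G] (E : ElementaryRelations R G)

theorem τ_zero : E.τ 0 = 1 := by
  have h := E.τ_add 0 0
  rwa [add_zero, left_eq_mul] at h

theorem δ_one : E.δ 1 = 1 := by
  have h := E.δ_mul 1 1 1 1 (mul_one 1) (mul_one 1)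
  rwa [mul_one, left_eq_mul] at h

theorem σ_mul_σ_mul (g : G) : E.σ * (E.σ * g) = g := by
  rw [← mul_assoc, E.σ_mul_self, one_mul]

theorem σ_mul_τ_mul_σ_mul {u u' : R} (h : u * u' = 1) (g : G) :
    E.σ * (E.τ u * (E.σ * g)) = E.τ (-u') * (E.σ * (E.δ u * (E.τ (-u') * g))) := by
  have h₁ := E.σ_mul_δ u u' h
  have h₂ := E.σ_mul_τ_mul_σ u u' h
  calc _ = E.σ * E.τ u * E.σ * g := by group
    _ = E.τ (-u') * (E.δ u' * E.σ) * E.τ (-u') * g := by rw [h₂]; group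
    _ = _ := by rw [← h₁]; group

variable (V : UnitChainNorm R)

open Classical in
/-- The value at a matrix `M` of the homomorphism determined by `E`, computed by running the
Euclidean algorithm on the first column of `M`. -/
noncomputable def eval (M : SpecialLinearGroup (Fin 2) R) : G :=
  if h : M 1 0 = 0 then E.τ (M 0 1 * M 0 0) * E.δ (M 0 0)
  else
    E.τ (V.exists_quotient (M 0 0) _ h).choose *
      (E.σ * eval (step (V.exists_quotient (M 0 0) _ h).choose M))
termination_by V.N (M 1 0)
decreasing_by exact (V.exists_quotient (M 0 0) _ h).choose_spec

theorem eval_of_eq_zero {M : SpecialLinearGroup (Fin 2) R} (h : M 1 0 = 0) :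
    E.eval V M = E.τ (M 0 1 * M 0 0) * E.δ (M 0 0) := by
  rw [eval, dif_pos h]

theorem exists_eval_eq {M : SpecialLinearGroup (Fin 2) R} (h : M 1 0 ≠ 0) :
    ∃ q, V.N (q * M 1 0 - M 0 0) < V.N (M 1 0) ∧
      E.eval V M = E.τ q * (E.σ * E.eval V (step q M)) :=
  ⟨_, (V.exists_quotient (M 0 0) _ h).choose_spec, by rw [eval, dif_neg h]⟩

/-- The values of `eval` are equivariant under the generators, for matrices with entries of norm
less than `n` in the relevant positions. -/
structure EquivariantBelow (n : ℕ) : Prop where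
  upper : ∀ (M : SpecialLinearGroup (Fin 2) R) x, V.N (M 1 0) < n →
    E.eval V (upper x * M) = E.τ x * E.eval V M
  diag : ∀ (M : SpecialLinearGroup (Fin 2) R) u u' h, V.N (M 1 0) < n →
    E.eval V (diag u u' h * M) = E.δ u * E.eval V M
  weyl : ∀ (M : SpecialLinearGroup (Fin 2) R), V.N (M 0 0) < n → V.N (M 1 0) < n →
    E.eval V (weyl * M) = E.σ * E.eval V M

variable {E V}

section Induction

variable [Nontrivial R] {n : ℕ} (H : E.EquivariantBelow V n)

include H

theorem EquivariantBelow.eval_neg {M M' : SpecialLinearGroup (Fin 2) R}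
    (hM : V.N (M 1 0) < n) (h : M' = BianchiPresentation.diag (-1) (-1) (by ring) * M) :
    E.eval V M' = E.eval V M := by
  rw [h, H.diag _ _ _ _ hM, E.δ_neg_one, one_mul]

theorem EquivariantBelow.step_unit {M : SpecialLinearGroup (Fin 2) R} (hM : V.N (M 1 0) ≤ n)
    {q u u' : R} (hu : u * u' = 1) (hq : V.N (q * M 1 0 - M 0 0) < V.N (M 1 0))
    (hqu : V.N ((q + u) * M 1 0 - M 0 0) < V.N (M 1 0)) :
    E.τ (q + u) * (E.σ * E.eval V (step (q + u) M)) = E.τ q * (E.σ * E.eval V (step q M)) := by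
  rw [E.τ_add, mul_assoc]
  congr 1
  have h₁ : V.N (step (q + u) M 1 0) < n := hqu.trans_le hM
  have hq' : V.N (M 0 0 - q * M 1 0) < n := by
    rw [← neg_sub, V.map_neg]
    exact hq.trans_le hM
  have e₀ : u * (M 1 0 + -(u' * ((q + u) * M 1 0 - M 0 0))) = M 0 0 - q * M 1 0 := by
    linear_combination (-((q + u) * M 1 0 - M 0 0)) * hu
  rw [← E.σ_mul_σ_mul (E.τ u * _), E.σ_mul_τ_mul_σ_mul hu, ← H.upper _ _ h₁,
    ← H.diag _ u u' hu (by simpa using h₁), ← H.weyl, ← H.upper]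
  · congr 1
    refine H.eval_neg (hq.trans_le hM) ?_
    apply ext_entries <;> simp [mul_apply]
    · linear_combination (-M 1 0 + u' * ((q + u) * M 1 0 - M 0 0)) * hu
    · linear_combination (-M 1 1 + u' * ((q + u) * M 1 1 - M 0 1)) * hu
    · linear_combination e₀
    · linear_combination (-((q + u) * M 1 1 - M 0 1)) * hu
  · simpa [mul_apply, e₀] using hq'
  · simpa [mul_apply, e₀] using hq'
  · simpa [mul_apply, V.map_mul, V.map_unit ((mul_comm u' u).trans hu)] using h₁

theorem EquivariantBelow.step_eq_step {M : SpecialLinearGroup (Fin 2) R} (hM : V.N (M 1 0) ≤ n)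
    {q r : R} (hq : V.N (q * M 1 0 - M 0 0) < V.N (M 1 0))
    (hr : V.N (r * M 1 0 - M 0 0) < V.N (M 1 0)) :
    E.τ r * (E.σ * E.eval V (step r M)) = E.τ q * (E.σ * E.eval V (step q M)) := by
  obtain ⟨s, rfl⟩ : ∃ s, r = q + s := ⟨r - q, by ring⟩
  have aux (t) : (q + t) * M 1 0 - M 0 0 = q * M 1 0 - M 0 0 + t * M 1 0 := by ring
  rcases V.chain _ _ s hq (aux s ▸ hr) with rfl | hs | ⟨u, v, hu, hv, rfl, huv⟩
  · rw [add_zero]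
  · obtain ⟨s', hs'⟩ := hs.exists_right_inv
    exact H.step_unit hM hs' hq hr
  · obtain ⟨u', hu'⟩ := hu.exists_right_inv
    obtain ⟨v', hv'⟩ := hv.exists_right_inv
    rw [← aux] at huv
    rw [← add_assoc] at hr ⊢
    rw [H.step_unit hM hv' huv hr, H.step_unit hM hu' hq huv]

theorem EquivariantBelow.eval_eq {M : SpecialLinearGroup (Fin 2) R} (hM : V.N (M 1 0) ≤ n)
    {q : R} (hq : V.N (q * M 1 0 - M 0 0) < V.N (M 1 0)) :
    E.eval V M = E.τ q * (E.σ * E.eval V (step q M)) := by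
  have h : M 1 0 ≠ 0 := fun h => by simp [(V.eq_zero_iff _).2 h] at hq
  obtain ⟨r, hr, e⟩ := E.exists_eval_eq V h
  rw [e, H.step_eq_step hM hq hr]

theorem EquivariantBelow.eval_upper_mul {M : SpecialLinearGroup (Fin 2) R}
    (hM : V.N (M 1 0) ≤ n) (x : R) : E.eval V (BianchiPresentation.upper x * M) =
      E.τ x * E.eval V M := by
  by_cases h : M 1 0 = 0
  · rw [E.eval_of_eq_zero V h, E.eval_of_eq_zero V (by simpa [mul_apply] using h), ← mul_assoc,
      ← E.τ_add]
    congr 2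
    · simp [mul_apply, h]
      linear_combination x * mul_eq_one_of_10_eq_zero h
    · simp [mul_apply, h]
  · obtain ⟨q, hq⟩ := V.exists_quotient (M 0 0) _ h
    rw [H.eval_eq hM hq, H.eval_eq (q := x + q), E.τ_add, mul_assoc]
    · congr 4
      apply ext_entries <;> simp [mul_apply] <;> ring
    · simpa [mul_apply] using hM
    · convert hq using 2 <;> simp [mul_apply]
      ring

theorem EquivariantBelow.eval_diag_mul {M : SpecialLinearGroup (Fin 2) R}
    (hM : V.N (M 1 0) ≤ n) (u u' : R) (hu : u * u' = 1) :
    E.eval V (BianchiPresentation.diag u u' hu * M) = E.δ u * E.eval V M := by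
  have hu' : u' * u = 1 := by rw [mul_comm, hu]
  by_cases h : M 1 0 = 0
  · rw [E.eval_of_eq_zero V h, E.eval_of_eq_zero V (by simp [mul_apply, h]), ← mul_assoc,
      E.δ_mul_τ _ _ _ hu, mul_assoc, ← E.δ_mul _ _ _ _ hu (mul_eq_one_of_10_eq_zero h)]
    congr 2
    · simp [mul_apply]
      ring
    · simp [mul_apply]
  · obtain ⟨q, hq⟩ := V.exists_quotient (M 0 0) _ h
    have e : step (u ^ 2 * q) (BianchiPresentation.diag u u' hu * M) =
        BianchiPresentation.diag u' u hu' * step q M := by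
      apply ext_entries <;> simp [mul_apply]
      · linear_combination (u * q * M 1 0) * hu
      · linear_combination (u * q * M 1 1) * hu
    have hq' : V.N (step (u ^ 2 * q) (BianchiPresentation.diag u u' hu * M) 1 0) < V.N (M 1 0) := by
      rw [e]
      simpa [mul_apply, V.map_mul, V.map_unit hu] using hq
    have h₁ : V.N ((BianchiPresentation.diag u u' hu * M) 1 0) = V.N (M 1 0) := by
      simp [mul_apply, V.map_mul, V.map_unit hu']
    rw [H.eval_eq hM hq, H.eval_eq (h₁.trans_le hM) (hq'.trans_eq h₁.symm), e,
      H.diag _ _ _ _ (hq.trans_le hM), ← mul_assoc (E.δ u), E.δ_mul_τ _ _ _ hu, mul_assoc,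
      ← mul_assoc E.σ (E.δ u'), E.σ_mul_δ _ _ hu', mul_assoc]

theorem EquivariantBelow.eval_weyl_mul_of_lt {M : SpecialLinearGroup (Fin 2) R}
    (h₀ : V.N (M 0 0) ≤ n) (h : V.N (M 1 0) < V.N (M 0 0)) :
    E.eval V (BianchiPresentation.weyl * M) = E.σ * E.eval V M := by
  rw [H.eval_eq (q := 0), E.τ_zero, one_mul]
  · congr 2
    apply ext_entries <;> simp [mul_apply]
  · simpa [mul_apply] using h₀
  · simpa [mul_apply] using h

theorem EquivariantBelow.eval_weyl_mul {M : SpecialLinearGroup (Fin 2) R}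
    (h₀ : V.N (M 0 0) ≤ n) (h₁ : V.N (M 1 0) ≤ n) :
    E.eval V (BianchiPresentation.weyl * M) = E.σ * E.eval V M := by
  rcases lt_trichotomy (V.N (M 1 0)) (V.N (M 0 0)) with h | h | h
  · exact H.eval_weyl_mul_of_lt h₀ h
  · have hM : M 1 0 ≠ 0 := by
      intro h0
      rw [h0, (V.eq_zero_iff 0).2 rfl, eq_comm, V.eq_zero_iff] at h
      simpa [h0, h] using det_eq M
    obtain ⟨u, hu, hlt⟩ := V.exists_unit_quotient (M 0 0) (M 1 0) hM h.symm
    obtain ⟨u', hu⟩ := hu.exists_right_inv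
    have hs : V.N (step u M 1 0) < n := hlt.trans_le h₁
    have e : step (-u') (BianchiPresentation.weyl * M) = BianchiPresentation.diag u u' hu *
        (BianchiPresentation.upper (-u') * step u M) := by
      apply ext_entries <;> simp [mul_apply]
      · linear_combination (u * M 1 0 - M 0 0) * hu
      · linear_combination (u * M 1 1 - M 0 1) * hu
      · linear_combination (-M 1 0) * hu
      · linear_combination (-M 1 1) * hu
    have hlt' : V.N (step (-u') (BianchiPresentation.weyl * M) 1 0) < V.N (M 0 0) := by
      rw [e, ← h]
      simpa [mul_apply, V.map_mul, V.map_unit ((mul_comm u' u).trans hu)] using hlt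
    have h₂ : V.N ((BianchiPresentation.weyl * M : SpecialLinearGroup (Fin 2) R) 1 0) =
        V.N (M 0 0) := by simp [mul_apply]
    rw [H.eval_eq (h₂.trans_le h₀) (hlt'.trans_eq h₂.symm), e, H.eval_eq h₁ hlt,
      E.σ_mul_τ_mul_σ_mul hu, H.diag _ _ _ _ (by simpa [mul_apply] using hs), H.upper _ _ hs]
  · have e : BianchiPresentation.weyl * (BianchiPresentation.weyl * M) =
        BianchiPresentation.diag (-1) (-1) (by ring) * M := by
      rw [← mul_assoc]
      congr 1
      apply ext_entries <;> simp [mul_apply]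
    have := H.eval_weyl_mul_of_lt (M := BianchiPresentation.weyl * M)
      (by simpa [mul_apply, V.map_neg] using h₁) (by simpa [mul_apply, V.map_neg] using h)
    rw [e, H.eval_diag_mul h₁, E.δ_neg_one, one_mul] at this
    rw [this, E.σ_mul_σ_mul]

end Induction

variable (E V) [Nontrivial R]

theorem equivariantBelow (n : ℕ) : E.EquivariantBelow V n := by
  induction n with
  | zero => constructor <;> simp
  | succ n H =>
    exact ⟨fun M x h => H.eval_upper_mul (Nat.le_of_lt_succ h) x,
      fun M u u' hu h => H.eval_diag_mul (Nat.le_of_lt_succ h) u u' hu,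
      fun M h₀ h₁ => H.eval_weyl_mul (Nat.le_of_lt_succ h₀) (Nat.le_of_lt_succ h₁)⟩

theorem eval_upper_mul (x : R) (M : SpecialLinearGroup (Fin 2) R) :
    E.eval V (upper x * M) = E.τ x * E.eval V M :=
  (E.equivariantBelow V _).eval_upper_mul le_rfl x

theorem eval_diag_mul {u u' : R} (hu : u * u' = 1) (M : SpecialLinearGroup (Fin 2) R) :
    E.eval V (diag u u' hu * M) = E.δ u * E.eval V M :=
  (E.equivariantBelow V _).eval_diag_mul le_rfl u u' hu

theorem eval_weyl_mul (M : SpecialLinearGroup (Fin 2) R) :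
    E.eval V (weyl * M) = E.σ * E.eval V M :=
  (E.equivariantBelow V _).eval_weyl_mul (le_max_left _ _) (le_max_right _ _)

theorem eval_one : E.eval V 1 = 1 := by
  rw [E.eval_of_eq_zero V (by simp)]
  simp [E.τ_zero, E.δ_one]

theorem eval_mul (A B : SpecialLinearGroup (Fin 2) R) :
    E.eval V (A * B) = E.eval V A * E.eval V B := by
  induction hn : V.N (A 1 0) using Nat.strong_induction_on generalizing A with
  | _ n ih =>
    by_cases h : A 1 0 = 0
    · have hA := mul_eq_one_of_10_eq_zero h
      rw [← upper_mul_diag h hA, mul_assoc, eval_upper_mul, eval_diag_mul, eval_upper_mul,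
        ← mul_one (diag _ _ _), eval_diag_mul, eval_one, mul_one, mul_assoc]
    · obtain ⟨q, hq⟩ := V.exists_quotient (A 0 0) _ h
      rw [← upper_mul_weyl_mul_step q A, mul_assoc, mul_assoc, eval_upper_mul, eval_weyl_mul,
        ih _ (hn ▸ hq) (step q A) rfl, eval_upper_mul, eval_weyl_mul, mul_assoc, mul_assoc]

/-- The homomorphism out of `SL(2, R)` determined by the images of the elementary matrices. -/
noncomputable def hom : SpecialLinearGroup (Fin 2) R →* G where
  toFun := E.eval V
  map_one' := E.eval_one V
  map_mul' := E.eval_mul V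

theorem hom_upper (x : R) : E.hom V (upper x) = E.τ x := by
  rw [← mul_one (upper x)]
  exact (E.eval_upper_mul V x 1).trans (by rw [eval_one, mul_one])

theorem hom_weyl : E.hom V weyl = E.σ := by
  rw [← mul_one weyl]
  exact (E.eval_weyl_mul V 1).trans (by rw [eval_one, mul_one])

theorem hom_neg_one : E.hom V (-1) = 1 := by
  have h : (-1 : SpecialLinearGroup (Fin 2) R) = weyl * weyl := by
    apply ext_entries <;> simp [mul_apply]
  rw [h, map_mul, hom_weyl, E.σ_mul_self]

end ElementaryRelations

section Wohlfahrt

variable {R G : Type*} [CommRing R] [Group G]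

/-- The matrix `A` is congruent to the identity modulo `n`. -/
def CongrOne (n : R) (A : SpecialLinearGroup (Fin 2) R) : Prop :=
  n ∣ A 0 0 - 1 ∧ n ∣ A 0 1 ∧ n ∣ A 1 0 ∧ n ∣ A 1 1 - 1

theorem map_eq_of_dvd_sub {ψ : SpecialLinearGroup (Fin 2) R →* G} {n : R}
    (hψ : ∀ A, CongrOne n A → ψ A = 1) {A B : SpecialLinearGroup (Fin 2) R}
    (h : ∀ i j, n ∣ A i j - B i j) : ψ A = ψ B := by
  rw [← mul_inv_eq_one, ← map_inv, ← map_mul]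
  apply hψ
  have hB := det_eq B
  have key (i j k l : Fin 2) (x y : R) :
      n ∣ (A i j - B i j) * x + (A k l - B k l) * y :=
    dvd_add ((h i j).mul_right x) ((h k l).mul_right y)
  refine ⟨?_, ?_, ?_, ?_⟩
  · convert key 0 0 0 1 (B 1 1) (-B 1 0) using 1
    simp [mul_apply, adjugate_fin_two]
    linear_combination hB
  · convert key 0 0 0 1 (-B 0 1) (B 0 0) using 1
    simp [mul_apply, adjugate_fin_two]
    ring
  · convert key 1 0 1 1 (B 1 1) (-B 1 0) using 1
    simp [mul_apply, adjugate_fin_two]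
    ring
  · convert key 1 0 1 1 (-B 0 1) (B 0 0) using 1
    simp [mul_apply, adjugate_fin_two]
    linear_combination hB

variable {ψ : SpecialLinearGroup (Fin 2) R →* G} {m n : R}

theorem map_lower_eq_one (hm : ∀ x, ψ (upper (m * x)) = 1) (x : R) :
    ψ (lower (m * x)) = 1 := by
  have h : lower (m * x) = weyl * upper (m * (-x)) * weyl⁻¹ := by
    rw [eq_mul_inv_iff_mul_eq]
    apply ext_entries <;> simp [mul_apply]
  rw [h, map_mul, map_mul, hm, mul_one, map_inv, mul_inv_cancel]

theorem map_eq_of_00_eq (hm : ∀ x, ψ (upper (m * x)) = 1) (hn : ∀ A, CongrOne n A → ψ A = 1)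
    {A B : SpecialLinearGroup (Fin 2) R} (h₀₀ : A 0 0 = B 0 0) (hcop : IsCoprime (A 0 0) n)
    (hA₀₁ : m ∣ A 0 1) (hA₁₀ : m ∣ A 1 0) (hB₀₁ : m ∣ B 0 1) (hB₁₀ : m ∣ B 1 0) :
    ψ A = ψ B := by
  obtain ⟨k, l, hkl⟩ := hcop
  obtain ⟨x, hx⟩ := (dvd_sub hB₀₁ hA₀₁).mul_right k
  obtain ⟨y, hy⟩ := (dvd_sub hB₁₀ hA₁₀).mul_right k
  have hC : ψ (lower (m * y) * A * upper (m * x)) = ψ A := by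
    rw [map_mul, map_mul, map_lower_eq_one hm, hm, mul_one, one_mul]
  rw [← hC]
  set C := lower (m * y) * A * upper (m * x) with hC_def
  have c₀₀ : C 0 0 = B 0 0 := by simp [hC_def, mul_apply, vecMul, dotProduct, h₀₀]
  have d₀₁ : n ∣ C 0 1 - B 0 1 := ⟨-l * (B 0 1 - A 0 1), by
    simp [hC_def, mul_apply, vecMul, dotProduct, ← hx]
    linear_combination (B 0 1 - A 0 1) * hkl⟩
  have d₁₀ : n ∣ C 1 0 - B 1 0 := ⟨-l * (B 1 0 - A 1 0), by
    simp [hC_def, mul_apply, vecMul, dotProduct, ← hy]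
    linear_combination (B 1 0 - A 1 0) * hkl⟩
  have d₁₁ : n ∣ C 1 1 - B 1 1 := by
    have h : C 1 1 - B 1 1 = (C 0 1 - B 0 1) * (k * C 1 0) + (C 1 0 - B 1 0) * (k * B 0 1) +
        n * (l * (C 1 1 - B 1 1)) := by
      have h₁ := det_eq C
      have h₂ := det_eq B
      rw [h₀₀] at hkl
      rw [c₀₀] at h₁
      linear_combination (-(C 1 1 - B 1 1)) * hkl + k * h₁ - k * h₂
    rw [h]
    exact dvd_add (dvd_add (d₀₁.mul_right _) (d₁₀.mul_right _)) (Dvd.intro _ rfl)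
  refine map_eq_of_dvd_sub hn fun i j => ?_
  fin_cases i <;> fin_cases j
  · simp [c₀₀]
  · exact d₀₁
  · exact d₁₀
  · exact d₁₁

variable [IsDomain R] [IsPrincipalIdealRing R]

theorem exists_isCoprime_add_mul {a b : R} (hab : IsCoprime a b) (hn : n ≠ 0) :
    ∃ k, IsCoprime (a + k * b) n := by
  induction n using UniqueFactorizationMonoid.induction_on_prime with
  | h₁ => exact absurd rfl hn
  | h₂ n h => exact ⟨0, isCoprime_one_right.of_isCoprime_of_dvd_right h.dvd⟩
  | h₃ n p h hp ih =>
    obtain ⟨k, hk⟩ := ih h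
    by_cases hpk : p ∣ a + k * b
    · have e : a + (k + n) * b = a + k * b + n * b := by ring
      refine ⟨k + n, IsCoprime.mul_right ?_ ?_⟩
      · refine ((Irreducible.coprime_iff_not_dvd hp.irreducible).2 fun hd => ?_).symm
        rw [e, dvd_add_right hpk] at hd
        rcases hp.dvd_or_dvd hd with hd | hd
        · exact hp.not_isUnit (hk.isUnit_of_dvd' hpk hd)
        · exact hp.not_isUnit
            (hab.isUnit_of_dvd' ((dvd_add_left (hd.mul_left k)).1 hpk) hd)
      · rw [e]
        exact hk.add_mul_left_left b
    · exact ⟨k, IsCoprime.mul_right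
        ((Irreducible.coprime_iff_not_dvd hp.irreducible).2 hpk).symm hk⟩

/-- Wohlfahrt's argument: a homomorphism out of `SL(2, R)` of level `m` which is trivial on some
principal congruence subgroup is trivial on the principal congruence subgroup modulo `m`. -/
theorem map_eq_one_of_congrOne (hm : ∀ x, ψ (upper (m * x)) = 1) (hn₀ : n ≠ 0)
    (hn : ∀ A, CongrOne n A → ψ A = 1) {W : SpecialLinearGroup (Fin 2) R}
    (hW : CongrOne m W) : ψ W = 1 := by
  obtain ⟨⟨r, hr⟩, h₀₁, h₁₀, h₁₁⟩ := hW
  have hcop : IsCoprime (W 0 0) (W 0 1 * m) := by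
    refine IsCoprime.mul_right ⟨W 1 1, -W 1 0, ?_⟩ ⟨1, -r, ?_⟩
    · linear_combination det_eq W
    · linear_combination hr
  obtain ⟨k, hk⟩ := exists_isCoprime_add_mul hcop hn₀
  have hB : ψ (upper 1 * lower (m * (r + k * W 0 1)) * upper (-1)) = 1 := by
    have h : upper (-1 : R) = (upper 1)⁻¹ := by
      rw [eq_inv_iff_mul_eq_one]
      apply ext_entries <;> simp [mul_apply]
    rw [h, map_mul, map_mul, map_lower_eq_one hm, mul_one, map_inv, mul_inv_cancel]
  have hA : ψ (W * lower (m * k)) = ψ W := by rw [map_mul, map_lower_eq_one hm, mul_one]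
  rw [← hA, ← hB]
  apply map_eq_of_00_eq hm hn
  · simp [mul_apply]
    linear_combination hr
  · convert hk using 1
    simp [mul_apply]
    ring
  · simpa [mul_apply] using h₀₁
  · simpa [mul_apply] using dvd_add h₁₀ ((Dvd.intro k rfl).mul_left (W 1 1))
  · simp [mul_apply]
  · simp [mul_apply]

end Wohlfahrt

/-- The ring `ℤ[ω]` with `ω ^ 2 = -1 + b * ω`. -/
abbrev QuadraticOrder (b : ℤ) := QuadraticAlgebra ℤ (-1) b

section Norm

variable {b : ℤ}

open QuadraticAlgebra

theorem norm_eq (z : QuadraticOrder b) : norm z = z.re ^ 2 + b * z.re * z.im + z.im ^ 2 := by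
  rw [QuadraticAlgebra.norm_def]
  ring

theorem norm_nonneg (hb : b = 0 ∨ b = 1) (z : QuadraticOrder b) : 0 ≤ norm z := by
  rw [norm_eq]
  rcases hb with rfl | rfl
  · nlinarith [sq_nonneg z.re, sq_nonneg z.im]
  · nlinarith [sq_nonneg (z.re + z.im), sq_nonneg z.re, sq_nonneg z.im]

theorem norm_eq_zero (hb : b = 0 ∨ b = 1) (z : QuadraticOrder b) : norm z = 0 ↔ z = 0 := by
  refine ⟨fun h => ?_, fun h => by rw [h, QuadraticAlgebra.norm_zero]⟩
  rw [norm_eq] at h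
  have h₁ : z.re ^ 2 = 0 := by
    rcases hb with rfl | rfl <;> nlinarith [sq_nonneg (z.re + z.im), sq_nonneg z.re, sq_nonneg z.im]
  have h₂ : z.im ^ 2 = 0 := by
    rcases hb with rfl | rfl <;> nlinarith [sq_nonneg (z.re + z.im), sq_nonneg z.re, sq_nonneg z.im]
  exact QuadraticAlgebra.ext (by simpa using h₁) (by simpa using h₂)

theorem norm_pos (hb : b = 0 ∨ b = 1) {z : QuadraticOrder b} (hz : z ≠ 0) : 0 < norm z :=
  lt_of_le_of_ne (norm_nonneg hb z) (fun h => hz ((norm_eq_zero hb z).1 h.symm))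

theorem isUnit_of_norm_eq_one {z : QuadraticOrder b} (hz : norm z = 1) : IsUnit z := by
  rw [isUnit_iff_norm_isUnit, hz]
  exact isUnit_one

theorem exists_abs_mul_sub_le {n : ℤ} (hn : 0 < n) (w : ℤ) : ∃ x, 2 * |n * x - w| ≤ n := by
  refine ⟨(2 * w + n) / (2 * n), ?_⟩
  have h₁ := Int.mul_ediv_add_emod (2 * w + n) (2 * n)
  have h₂ := Int.emod_nonneg (2 * w + n) (show 2 * n ≠ 0 by positivity)
  have h₃ := Int.emod_lt_of_pos (2 * w + n) (show 0 < 2 * n by positivity)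
  have h₄ : |2 * (n * ((2 * w + n) / (2 * n)) - w)| ≤ n := by
    rw [abs_le]
    constructor <;> linarith
  rwa [abs_mul, abs_two] at h₄

theorem exists_norm_mul_sub_lt (hb : b = 0 ∨ b = 1) (a : QuadraticOrder b) {c : QuadraticOrder b}
    (hc : c ≠ 0) : ∃ q : QuadraticOrder b, norm (q * c - a) < norm c := by
  have hn := norm_pos hb hc
  obtain ⟨x, hx⟩ := exists_abs_mul_sub_le hn (a * star c).re
  obtain ⟨y, hy⟩ := exists_abs_mul_sub_le hn (a * star c).im
  refine ⟨⟨x, y⟩, lt_of_mul_lt_mul_right ?_ hn.le⟩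
  have h : norm ((⟨x, y⟩ * c - a) * star c) = (norm c * x - (a * star c).re) ^ 2 +
      b * (norm c * x - (a * star c).re) * (norm c * y - (a * star c).im) +
      (norm c * y - (a * star c).im) ^ 2 := by
    rw [norm_eq, norm_eq]
    simp
    ring
  rw [map_mul, QuadraticAlgebra.norm_star] at h
  rw [h]
  rw [← abs_two, ← abs_mul, abs_le] at hx hy
  generalize norm c * x - (a * star c).re = s at *
  generalize norm c * y - (a * star c).im = t at *
  generalize norm c = n at *
  rcases hb with rfl | rfl <;> nlinarith

theorem exists_isUnit_norm_mul_sub_lt (hb : b = 0 ∨ b = 1) {a c : QuadraticOrder b} (hc : c ≠ 0)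
    (hac : norm a = norm c) : ∃ u : QuadraticOrder b, IsUnit u ∧ norm (u * c - a) < norm c := by
  have hn := norm_pos hb hc
  by_contra! H
  have hw : norm (c * star a) = norm c * norm c := by rw [map_mul, QuadraticAlgebra.norm_star, hac]
  have key (u : QuadraticOrder b) (hu : norm u = 1) :
      2 * (u * (c * star a)).re + b * (u * (c * star a)).im ≤ norm c := by
    have h : norm (u * c - a) = norm u * norm c + norm a -
        (2 * (u * (c * star a)).re + b * (u * (c * star a)).im) := by
      simp only [norm_eq]
      simp
      ring
    have := H u (isUnit_of_norm_eq_one hu)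
    rw [h, hu, hac] at this
    linarith
  rw [norm_eq] at hw
  generalize c * star a = w at *
  generalize norm c = n at *
  have h₁ := key ⟨1, 0⟩ (by simp [norm_eq])
  have h₂ := key ⟨-1, 0⟩ (by simp [norm_eq])
  have h₃ := key ⟨0, 1⟩ (by simp [norm_eq])
  have h₄ := key ⟨0, -1⟩ (by simp [norm_eq])
  rcases hb with rfl | rfl
  · simp at h₁ h₂ h₃ h₄
    nlinarith
  · have h₅ := key ⟨1, -1⟩ (by simp [norm_eq])
    have h₆ := key ⟨-1, 1⟩ (by simp [norm_eq])
    simp at h₁ h₂ h₃ h₄ h₅ h₆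
    nlinarith

theorem exists_units_add_of_norm_le (hb : b = 0 ∨ b = 1) {q : QuadraticOrder b} (hq : norm q ≤ 3) :
    q = 0 ∨ norm q = 1 ∨
      ∃ u v : QuadraticOrder b, norm u = 1 ∧ norm v = 1 ∧ q = u + v ∧ 2 ≤ norm q := by
  obtain ⟨x, y⟩ := q
  have H : ∀ b ∈ Finset.Icc (0 : ℤ) 1, ∀ x ∈ Finset.Icc (-2 : ℤ) 2, ∀ y ∈ Finset.Icc (-2 : ℤ) 2,
      x ^ 2 + b * x * y + y ^ 2 ≤ 3 → (x = 0 ∧ y = 0) ∨ x ^ 2 + b * x * y + y ^ 2 = 1 ∨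
      ∃ s ∈ Finset.Icc (-1 : ℤ) 1, ∃ t ∈ Finset.Icc (-1 : ℤ) 1,
        s ^ 2 + b * s * t + t ^ 2 = 1 ∧
        (x - s) ^ 2 + b * (x - s) * (y - t) + (y - t) ^ 2 = 1 ∧
        2 ≤ x ^ 2 + b * x * y + y ^ 2 := by
    decide +kernel
  rw [norm_eq] at hq ⊢
  dsimp only at hq ⊢
  have hx : -2 ≤ x ∧ x ≤ 2 := by
    constructor <;> rcases hb with rfl | rfl <;> nlinarith [sq_nonneg (2 * y + x), sq_nonneg y]
  have hy : -2 ≤ y ∧ y ≤ 2 := by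
    constructor <;> rcases hb with rfl | rfl <;> nlinarith [sq_nonneg (2 * x + y), sq_nonneg x]
  rcases H b (by simp; omega) x (by simpa using hx) y (by simpa using hy) hq with
    ⟨rfl, rfl⟩ | h | ⟨s, -, t, -, h₁, h₂, h₃⟩
  · exact Or.inl rfl
  · exact Or.inr (Or.inl h)
  · exact Or.inr (Or.inr ⟨⟨s, t⟩, ⟨x - s, y - t⟩, by rwa [norm_eq], by rwa [norm_eq],
      QuadraticAlgebra.ext (by simp) (by simp), h₃⟩)

theorem norm_add_mul_lt_or {x c u v : QuadraticOrder b} (hu : norm u = 1) (hv : norm v = 1)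
    (huv : 2 ≤ norm (u + v)) (hc : 0 ≤ norm c) (h₁ : norm x < norm c)
    (h₂ : norm (x + (u + v) * c) < norm c) :
    norm (x + u * c) < norm c ∨ norm (x + v * c) < norm c := by
  have h : norm (x + u * c) + norm (x + v * c) = norm x + norm (x + (u + v) * c) +
      norm c * (norm u + norm v - norm (u + v)) := by
    simp only [norm_eq]
    simp
    ring
  rw [hu, hv] at h
  by_contra! H
  nlinarith

theorem norm_le_three {x c q : QuadraticOrder b} (hb : b = 0 ∨ b = 1) (h₁ : norm x < norm c)
    (h₂ : norm (x + q * c) < norm c) : norm q ≤ 3 := by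
  have h : norm q * norm c + norm (x + x + q * c) = 2 * (norm x + norm (x + q * c)) := by
    simp only [norm_eq]
    simp
    ring
  have h₀ := norm_nonneg hb (x + x + q * c)
  have := norm_nonneg hb x
  by_contra! H
  nlinarith

/-- The norm of the ring of Gaussian (`b = 0`) or Eisenstein (`b = 1`) integers. -/
def unitChainNorm (hb : b = 0 ∨ b = 1) : UnitChainNorm (QuadraticOrder b) where
  N z := (norm z).natAbs
  map_mul x y := by rw [map_mul, Int.natAbs_mul]
  eq_zero_iff z := by rw [Int.natAbs_eq_zero, norm_eq_zero hb]
  exists_quotient a c hc := by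
    obtain ⟨q, hq⟩ := exists_norm_mul_sub_lt hb a hc
    exact ⟨q, Int.natAbs_lt_natAbs_of_nonneg_of_lt (norm_nonneg hb _) hq⟩
  exists_unit_quotient a c hc h := by
    obtain ⟨u, hu, hlt⟩ := exists_isUnit_norm_mul_sub_lt hb hc (a := a)
      (by have := norm_nonneg hb a; have := norm_nonneg hb c; omega)
    exact ⟨u, hu, Int.natAbs_lt_natAbs_of_nonneg_of_lt (norm_nonneg hb _) hlt⟩
  chain x c q h₁ h₂ := by
    have hlt (y z : QuadraticOrder b) : (norm y).natAbs < (norm z).natAbs ↔ norm y < norm z := by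
      have := norm_nonneg hb y
      have := norm_nonneg hb z
      omega
    simp only [hlt] at *
    rcases exists_units_add_of_norm_le hb (norm_le_three hb h₁ h₂) with
      h | h | ⟨u, v, hu, hv, rfl, h⟩
    · exact Or.inl h
    · exact Or.inr (Or.inl (isUnit_of_norm_eq_one h))
    · refine Or.inr (Or.inr ?_)
      rcases norm_add_mul_lt_or hu hv h (norm_nonneg hb c) h₁ h₂ with h | h
      · exact ⟨u, v, isUnit_of_norm_eq_one hu, isUnit_of_norm_eq_one hv, rfl, h⟩
      · exact ⟨v, u, isUnit_of_norm_eq_one hv, isUnit_of_norm_eq_one hu, add_comm _ _, h⟩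

end Norm

section Generators

open QuadraticAlgebra

variable {b : ℤ}

theorem norm_eq_one_of_mul_eq_one (hb : b = 0 ∨ b = 1) {u u' : QuadraticOrder b}
    (h : u * u' = 1) : norm u = 1 := by
  have h₁ : norm u * norm u' = 1 := by rw [← map_mul, h, map_one]
  exact (Int.isUnit_iff.1 (.of_mul_eq_one _ h₁)).resolve_right
    (by have := norm_nonneg hb u; omega)

theorem eq_star_of_mul_eq_one (hb : b = 0 ∨ b = 1) {u u' : QuadraticOrder b}
    (h : u * u' = 1) : u' = star u := by
  have h₁ := algebraMap_norm_eq_mul_star u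
  rw [norm_eq_one_of_mul_eq_one hb h, map_one] at h₁
  rw [← one_mul u', h₁, mul_right_comm, h, one_mul]

variable {G : Type*} [Group G]

/-- The homomorphism from the additive group of `ℤ[ω]` determined by the images of `1` and `ω`. -/
def translation (t s : G) (x : QuadraticOrder b) : G := t ^ x.re * s ^ x.im

variable {t s : G}

theorem translation_add (h : t * s = s * t) (x y : QuadraticOrder b) :
    translation t s (x + y) = translation t s x * translation t s y := by
  have h' : Commute t s := h
  simp only [translation, re_add, im_add, _root_.zpow_add]
  rw [mul_assoc, mul_assoc, ← mul_assoc (t ^ y.re), (h'.zpow_zpow y.re x.im).eq, mul_assoc]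

theorem translation_zpow (h : t * s = s * t) (x : QuadraticOrder b) (n : ℤ) :
    translation t s x ^ n = translation t s ((n : QuadraticOrder b) * x) := by
  have h' : Commute t s := h
  simp only [translation]
  rw [(h'.zpow_zpow x.re x.im).mul_zpow, ← _root_.zpow_mul, ← _root_.zpow_mul]
  simp [mul_comm]

theorem mul_translation (h : t * s = s * t) {w : QuadraticOrder b} {g : G}
    (h₁ : g * t = translation t s w * g) (h₂ : g * s = translation t s (w * ω) * g)
    (x : QuadraticOrder b) : g * translation t s x = translation t s (w * x) * g := by
  have e : w * x = (x.re : QuadraticOrder b) * w + (x.im : QuadraticOrder b) * (w * ω) := by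
    ext <;> simp <;> ring
  rw [e, translation_add h, ← translation_zpow h, ← translation_zpow h,
    ← mul_inv_eq_iff_eq_mul.2 h₁, ← mul_inv_eq_iff_eq_mul.2 h₂]
  simp [translation, conj_zpow]

theorem translation_mul_eq_one {m : ℤ} (ht : t ^ m = 1) (hs : s ^ m = 1) (x : QuadraticOrder b) :
    translation t s ((m : QuadraticOrder b) * x) = 1 := by
  simp [translation, _root_.zpow_mul, ht, hs]

/-- The elementary relations over `ℤ[ω]`, reduced to finitely many relations between generators. -/
def relationsOfGenerators (hb : b = 0 ∨ b = 1) (U : List (QuadraticOrder b))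
    (hU : ∀ u : QuadraticOrder b, QuadraticAlgebra.norm u = 1 → u ∈ U) (t s σ : G)
    (δ : QuadraticOrder b → G) (hts : t * s = s * t)
    (hσ : σ * σ = 1) (hδ : δ (-1) = 1) (hδ_mul : ∀ u ∈ U, ∀ v ∈ U, δ (u * v) = δ u * δ v)
    (hδ_one : ∀ u ∈ U, δ u * t = translation t s (u ^ 2) * δ u)
    (hδ_omega : ∀ u ∈ U, δ u * s = translation t s (u ^ 2 * ω) * δ u)
    (hσ_mul_δ : ∀ u ∈ U, σ * δ u = δ (star u) * σ)
    (hσ_mul : ∀ u ∈ U, σ * translation t s u * σ =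
      translation t s (-star u) * δ (star u) * σ * translation t s (-star u)) :
    ElementaryRelations (QuadraticOrder b) G where
  τ := translation t s
  σ := σ
  δ := δ
  τ_add := translation_add hts
  σ_mul_self := hσ
  δ_neg_one := hδ
  δ_mul u u' v v' hu hv := hδ_mul u (hU u (norm_eq_one_of_mul_eq_one hb hu)) v
    (hU v (norm_eq_one_of_mul_eq_one hb hv))
  δ_mul_τ u u' x hu := by
    have h := hU u (norm_eq_one_of_mul_eq_one hb hu)
    exact mul_translation hts (hδ_one u h) (hδ_omega u h) x
  σ_mul_δ u u' hu := by
    rw [eq_star_of_mul_eq_one hb hu, hσ_mul_δ u (hU u (norm_eq_one_of_mul_eq_one hb hu))]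
  σ_mul_τ_mul_σ u u' hu := by
    rw [eq_star_of_mul_eq_one hb hu, hσ_mul u (hU u (norm_eq_one_of_mul_eq_one hb hu))]

theorem mem_of_norm_eq_one_gauss (u : QuadraticOrder 0) (hu : norm u = 1) :
    u ∈ ([1, -1, ω, -ω] : List (QuadraticOrder 0)) := by
  obtain ⟨x, y⟩ := u
  rw [norm_eq] at hu
  dsimp only at hu
  have hx : -1 ≤ x ∧ x ≤ 1 := by constructor <;> nlinarith [sq_nonneg y]
  have hy : -1 ≤ y ∧ y ≤ 1 := by constructor <;> nlinarith [sq_nonneg x]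
  obtain ⟨hx₁, hx₂⟩ := hx
  obtain ⟨hy₁, hy₂⟩ := hy
  interval_cases x <;> interval_cases y <;> first | decide | simp at hu

theorem mem_of_norm_eq_one_eisenstein (u : QuadraticOrder 1) (hu : norm u = 1) :
    u ∈ ([1, -1, ω, -ω, 1 - ω, ω - 1] : List (QuadraticOrder 1)) := by
  obtain ⟨x, y⟩ := u
  rw [norm_eq] at hu
  dsimp only at hu
  have hx : -1 ≤ x ∧ x ≤ 1 := by constructor <;> nlinarith [sq_nonneg (2 * y + x)]
  have hy : -1 ≤ y ∧ y ≤ 1 := by constructor <;> nlinarith [sq_nonneg (2 * x + y)]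
  obtain ⟨hx₁, hx₂⟩ := hx
  obtain ⟨hy₁, hy₂⟩ := hy
  interval_cases x <;> interval_cases y <;> first | decide | simp at hu

end Generators

section Permutations

open QuadraticAlgebra

/-- The image of the Weyl element. -/
def gaussWeyl : Equiv.Perm (Fin 6) where
  toFun := ![1, 0, 5, 4, 3, 2]
  invFun := ![1, 0, 5, 4, 3, 2]
  left_inv := by decide
  right_inv := by decide

/-- The image of the diagonal matrix with entries `ω` and `ω⁻¹`. -/
def gaussDiag : Equiv.Perm (Fin 6) where
  toFun := ![1, 0, 3, 2, 5, 4]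
  invFun := ![1, 0, 3, 2, 5, 4]
  left_inv := by decide
  right_inv := by decide

/-- The image of the elementary matrix with entry `1`. -/
def gaussOne : Equiv.Perm (Fin 6) where
  toFun := ![2, 3, 0, 1, 5, 4]
  invFun := ![2, 3, 0, 1, 5, 4]
  left_inv := by decide
  right_inv := by decide

/-- The image of the elementary matrix with entry `ω`. -/
def gaussOmega : Equiv.Perm (Fin 6) where
  toFun := ![4, 2, 5, 0, 3, 1]
  invFun := ![3, 5, 1, 4, 0, 2]
  left_inv := by decide
  right_inv := by decide

/-- The image of the Weyl element. -/
def eisensteinWeyl : Equiv.Perm (Fin 24) where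
  toFun := ![0, 5, 9, 10, 12, 1, 16, 13, 17, 2, 3, 11, 4, 7, 14, 20, 6, 8, 18, 22, 15, 23, 19, 21]
  invFun := ![0, 5, 9, 10, 12, 1, 16, 13, 17, 2, 3, 11, 4, 7, 14, 20, 6, 8, 18, 22, 15, 23, 19, 21]
  left_inv := by decide
  right_inv := by decide

/-- The image of the diagonal matrix with entries `ω` and `ω⁻¹`. -/
def eisensteinDiag : Equiv.Perm (Fin 24) where
  toFun := ![0, 7, 3, 8, 1, 12, 6, 4, 2, 17, 9, 11, 13, 5, 20, 14, 16, 10, 18, 19, 15, 21, 22, 23]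
  invFun := ![0, 4, 8, 2, 7, 13, 6, 1, 3, 10, 17, 11, 5, 12, 15, 20, 16, 9, 18, 19, 14, 21, 22, 23]
  left_inv := by decide
  right_inv := by decide

/-- The image of the elementary matrix with entry `1`. -/
def eisensteinOne : Equiv.Perm (Fin 24) where
  toFun := ![3, 0, 7, 1, 11, 15, 2, 6, 4, 19, 5, 8, 20, 18, 21, 17, 23, 12, 9, 14, 10, 13, 16, 22]
  invFun := ![1, 3, 6, 0, 8, 10, 7, 2, 11, 18, 20, 4, 17, 21, 19, 5, 22, 15, 13, 9, 12, 14, 23, 16]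
  left_inv := by decide
  right_inv := by decide

/-- The image of the elementary matrix with entry `ω`. -/
def eisensteinOmega : Equiv.Perm (Fin 24) where
  toFun := ![4, 8, 0, 11, 2, 9, 1, 3, 6, 20, 18, 7, 21, 17, 5, 19, 22, 14, 12, 10, 13, 15, 23, 16]
  invFun := ![2, 6, 4, 7, 0, 14, 8, 11, 1, 5, 19, 3, 18, 20, 17, 21, 23, 13, 10, 15, 9, 12, 16, 22]
  left_inv := by decide
  right_inv := by decide


/-- The representation of `PSL(2, ℤ[i])` on six points. -/
def gaussRelations : ElementaryRelations (QuadraticOrder 0) (Equiv.Perm (Fin 6)) :=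
  relationsOfGenerators (.inl rfl) [1, -1, ω, -ω] mem_of_norm_eq_one_gauss gaussOne gaussOmega
    gaussWeyl (fun u => if u = 1 ∨ u = -1 then 1 else gaussDiag)
    (by decide +kernel) (by decide +kernel) (by decide +kernel) (by decide +kernel)
    (by decide +kernel) (by decide +kernel) (by decide +kernel) (by decide +kernel)

/-- The representation of `PSL(2, ℤ[ζ])` on twenty-four points, where `ζ` is a primitive sixth root
of unity. -/
def eisensteinRelations : ElementaryRelations (QuadraticOrder 1) (Equiv.Perm (Fin 24)) :=
  relationsOfGenerators (.inr rfl) [1, -1, ω, -ω, 1 - ω, ω - 1] mem_of_norm_eq_one_eisenstein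
    eisensteinOne eisensteinOmega eisensteinWeyl
    (fun u => if u = 1 ∨ u = -1 then 1 else
      if u = ω ∨ u = -ω then eisensteinDiag else eisensteinDiag * eisensteinDiag)
    (by decide +kernel) (by decide +kernel) (by decide +kernel) (by decide +kernel)
    (by decide +kernel) (by decide +kernel) (by decide +kernel) (by decide +kernel)

/-- A relation between elementary matrices modulo `m` which fails for a homomorphism of level `m`
shows that its kernel is not a congruence subgroup. -/
theorem exists_congrOne_of_relations (hb : b = 0 ∨ b = 1) {G : Type*} [Group G]
    (E : ElementaryRelations (QuadraticOrder b) G) {m : QuadraticOrder b}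
    (hm : ∀ x, E.τ (m * x) = 1) {A B : SpecialLinearGroup (Fin 2) (QuadraticOrder b)}
    (hAB : ∀ i j, m ∣ A i j - B i j)
    (hne : E.hom (unitChainNorm hb) A ≠ E.hom (unitChainNorm hb) B)
    {n : QuadraticOrder b} (hn : n ≠ 0) :
    ∃ M, CongrOne n M ∧ E.hom (unitChainNorm hb) M ≠ 1 := by
  by_contra! H
  have := (unitChainNorm hb).isDomain
  have := (unitChainNorm hb).isPrincipalIdealRing
  exact hne (map_eq_of_dvd_sub (fun M hM => map_eq_one_of_congrOne
    (fun x => (E.hom_upper _ _).trans (hm x)) hn H hM) hAB)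

theorem exists_hom_gauss : ∃ ψ : SpecialLinearGroup (Fin 2) (QuadraticOrder 0) →*
    Equiv.Perm (Fin 6), ψ (-1) = 1 ∧ ∀ n, n ≠ 0 → ∃ M, CongrOne n M ∧ ψ M ≠ 1 := by
  refine ⟨gaussRelations.hom (unitChainNorm (.inl rfl)), gaussRelations.hom_neg_one _,
    fun n hn => exists_congrOne_of_relations (m := 6)
      (A := upper 3 * (weyl * upper (2 * ω) * weyl)) (B := weyl * upper (2 * ω) * weyl * upper 3)
      (.inl rfl) gaussRelations (fun x => ?_) (fun i j => ?_) ?_ hn⟩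
  · exact translation_mul_eq_one (m := 6) (by decide +kernel) (by decide +kernel) x
  · exact ⟨!![ω, 0; 0, -ω] i j, by revert i j; decide +kernel⟩
  · simp only [map_mul, ElementaryRelations.hom_upper, ElementaryRelations.hom_weyl]
    decide +kernel

theorem exists_hom_eisenstein : ∃ ψ : SpecialLinearGroup (Fin 2) (QuadraticOrder 1) →*
    Equiv.Perm (Fin 24), ψ (-1) = 1 ∧ ∀ n, n ≠ 0 → ∃ M, CongrOne n M ∧ ψ M ≠ 1 := by
  refine ⟨eisensteinRelations.hom (unitChainNorm (.inr rfl)), eisensteinRelations.hom_neg_one _,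
    fun n hn => exists_congrOne_of_relations (m := 6)
      (A := upper 2 * (weyl * upper (-2) * weyl))
      (B := -1 * (weyl * upper 2 * weyl * upper (-2)))
      (.inr rfl) eisensteinRelations (fun x => ?_) (fun i j => ?_) ?_ hn⟩
  · exact translation_mul_eq_one (m := 6) (by decide +kernel) (by decide +kernel) x
  · exact ⟨!![-1, 0; 0, -1] i j, by revert i j; decide +kernel⟩
  · simp only [map_mul, ElementaryRelations.hom_upper, ElementaryRelations.hom_weyl,
      ElementaryRelations.hom_neg_one]
    decide +kernel

end Permutations

section RingOfIntegers

open QuadraticAlgebra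

variable {F : Type*} [Field F] {b : ℤ} {θ : F}

theorem lift_injective [CharZero F] (hb : b = 0 ∨ b = 1)
    (hθ : θ * θ = (-1 : ℤ) • 1 + b • θ) :
    Function.Injective (lift ⟨θ, hθ⟩ : QuadraticOrder b →ₐ[ℤ] F) := by
  rw [injective_iff_map_eq_zero]
  intro x hx
  have h := congrArg (lift ⟨θ, hθ⟩ : QuadraticOrder b →ₐ[ℤ] F) (algebraMap_norm_eq_mul_star x)
  rw [map_mul, hx, zero_mul, AlgHom.commutes, eq_intCast, Int.cast_eq_zero] at h
  exact (norm_eq_zero hb x).1 h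

theorem exists_eq_add_mul [NumberField F] (hb : b = 0 ∨ b = 1)
    (hF : Module.finrank ℚ F = 2) (hθ : θ * θ = (-1 : ℤ) • 1 + b • θ) (z : F) :
    ∃ p q : ℚ, z = p + q * θ := by
  have hθ' : θ * θ = (-1 : ℚ) • 1 + (b : ℚ) • θ := by
    simpa [Algebra.smul_def] using hθ
  let φ : QuadraticAlgebra ℚ (-1) (b : ℚ) →ₐ[ℚ] F := lift ⟨θ, hθ'⟩
  have hφ : Function.Injective φ := by
    rw [injective_iff_map_eq_zero]
    intro x hx
    have h := congrArg φ (algebraMap_norm_eq_mul_star x)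
    rw [map_mul, hx, zero_mul, AlgHom.commutes, map_eq_zero, QuadraticAlgebra.norm_def] at h
    have h₁ : x.re ^ 2 = 0 := by
      rcases hb with rfl | rfl <;> push_cast at h <;>
        nlinarith [sq_nonneg (x.re + x.im), sq_nonneg x.re, sq_nonneg x.im]
    have h₂ : x.im ^ 2 = 0 := by
      rcases hb with rfl | rfl <;> push_cast at h <;>
        nlinarith [sq_nonneg (x.re + x.im), sq_nonneg x.re, sq_nonneg x.im]
    exact QuadraticAlgebra.ext (by simpa using h₁) (by simpa using h₂)
  have hs : Function.Surjective φ.toLinearMap :=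
    (LinearMap.injective_iff_surjective_of_finrank_eq_finrank
      (by rw [hF, QuadraticAlgebra.finrank_eq_two])).1 hφ
  obtain ⟨x, hx⟩ := hs z
  refine ⟨x.re, x.im, ?_⟩
  rw [← hx]
  simp [φ, lift, Algebra.smul_def]

/-- The ring of integers of a quadratic field containing a root `θ` of `X ^ 2 - b * X + 1` is
`ℤ[θ]`. -/
theorem nonempty_ringOfIntegers_equiv [NumberField F] (hb : b = 0 ∨ b = 1)
    (hF : Module.finrank ℚ F = 2) (hθ : θ * θ = (-1 : ℤ) • 1 + b • θ) :
    Nonempty (𝓞 F ≃+* QuadraticOrder b) := by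
  let φ : QuadraticOrder b →ₐ[ℤ] F := lift ⟨θ, hθ⟩
  have hφ : Function.Injective φ := lift_injective hb hθ
  have := (unitChainNorm hb).isDomain
  have := (unitChainNorm hb).isPrincipalIdealRing
  let _ : Algebra (QuadraticOrder b) F := φ.toRingHom.toAlgebra
  have : FaithfulSMul (QuadraticOrder b) F := (faithfulSMul_iff_algebraMap_injective _ _).2 hφ
  have : IsFractionRing (QuadraticOrder b) F := by
    refine .of_field _ _ fun z => ?_
    obtain ⟨p, q, rfl⟩ := exists_eq_add_mul hb hF hθ z
    refine ⟨⟨p.num * q.den, q.num * p.den⟩, ((p.den * q.den : ℤ) : QuadraticOrder b), ?_⟩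
    rw [map_intCast]
    have h : algebraMap (QuadraticOrder b) F ⟨p.num * q.den, q.num * p.den⟩ =
        p.num * q.den + q.num * p.den * θ := by
      simp [RingHom.algebraMap_toAlgebra, φ, lift, Algebra.smul_def]
    rw [h]
    have hp : (p.den : F) ≠ 0 := Nat.cast_ne_zero.2 p.den_ne_zero
    have hq : (q.den : F) ≠ 0 := Nat.cast_ne_zero.2 q.den_ne_zero
    conv_lhs => rw [Rat.cast_def p, Rat.cast_def q]
    push_cast
    field_simp
  have h_integral (x : QuadraticOrder b) : φ x ∈ integralClosure ℤ F := by
    have hω : IsIntegral ℤ θ := by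
      refine ⟨Polynomial.X ^ 2 - Polynomial.C b * Polynomial.X + 1, by monicity!, ?_⟩
      simp [pow_two, hθ, -eq_intCast]
    have h : φ x = x.re + x.im * θ := by simp [φ, lift, Algebra.smul_def]
    rw [h]
    exact (isIntegral_intCast _).add ((isIntegral_intCast _).mul hω)
  refine ⟨(RingEquiv.ofBijective
    (φ.toRingHom.codRestrict (integralClosure ℤ F) h_integral) ⟨fun x y h => ?_, fun y => ?_⟩).symm⟩
  · exact hφ (congrArg Subtype.val h)
  · obtain ⟨x, hx⟩ := IsIntegrallyClosed.isIntegral_iff.1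
      (IsIntegral.tower_top (R := ℤ) (A := QuadraticOrder b) y.2)
    exact ⟨x, Subtype.ext hx⟩

end RingOfIntegers

section Transfer

variable {F : Type*} [Field F] [NumberField F] {R G : Type*} [CommRing R] [Group G] [Finite G]

/-- A homomorphism out of `SL(2, R)` to a finite group which kills `-1` but no principal congruence
subgroup yields a normal non-congruence subgroup of finite index. -/
theorem exists_not_isCongruence (f : 𝓞 F ≃+* R) (ψ : SpecialLinearGroup (Fin 2) R →* G)
    (hψ : ψ (-1) = 1) (hn : ∀ n, n ≠ 0 → ∃ M, CongrOne n M ∧ ψ M ≠ 1) :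
    ∃ N : Subgroup (PSL F), N.Normal ∧ N.FiniteIndex ∧ ¬ IsCongruence F N := by
  let Ψ := ψ.comp (SpecialLinearGroup.map (n := Fin 2) (f : 𝓞 F →+* R))
  have hΨ : PM F ≤ Ψ.ker := by
    rw [PM, Subgroup.closure_le, Set.singleton_subset_iff, SetLike.mem_coe, MonoidHom.mem_ker]
    refine Eq.trans (congrArg ψ ?_) hψ
    apply ext_entries <;> simp
  let Φ : PSL F →* G := QuotientGroup.lift (PM F) Ψ hΨ
  refine ⟨Φ.ker, inferInstance, inferInstance, ?_⟩
  rintro ⟨π, hπ, hle⟩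
  obtain ⟨x, hx, hx₀⟩ := π.exists_mem_ne_zero_of_ne_bot hπ
  obtain ⟨M, ⟨h₀₀, h₀₁, h₁₀, h₁₁⟩, hM⟩ := hn (f x) ((map_ne_zero_iff f f.injective).2 hx₀)
  have key {y : R} (hy : f x ∣ y) : Ideal.Quotient.mk π (f.symm y) = 0 := by
    obtain ⟨c, rfl⟩ := hy
    rw [Ideal.Quotient.eq_zero_iff_mem, map_mul, f.symm_apply_apply]
    exact π.mul_mem_right _ hx
  let A := SpecialLinearGroup.map (n := Fin 2) (f.symm : R →+* 𝓞 F) M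
  have hA : red F π A = 1 := by
    apply ext_entries
    · simpa [red, A, sub_eq_zero] using key h₀₀
    · simpa [red, A] using key h₀₁
    · simpa [red, A] using key h₁₀
    · simpa [red, A, sub_eq_zero] using key h₁₁
  have hmem : proj F A ∈ Gbar F π :=
    Subgroup.mem_map_of_mem _ (by rw [Subgroup.mem_comap, hA]; exact one_mem _)
  apply hM
  have h : Ψ A = 1 := hle hmem
  rw [← h]
  refine congrArg ψ ?_
  apply ext_entries <;> simp [A]

end Transfer

end BianchiPresentation

/-- **Proposition 5.4.** For `d = −1` and for `d = −3`, the Bianchi group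
`B_d = PSL(2, O_d)` (where `O_d` is the ring of integers of `K = ℚ(√d)`) has a normal
non-congruence subgroup of finite index. -/
theorem bianchi_noncongruence_minus_one_minus_three
    (d : ℤ) (hd : d = -1 ∨ d = -3)
    (hK2 : Module.finrank ℚ K = 2) (α : K) (hα : α ^ 2 = (d : K)) :
    ∃ N : Subgroup (PSL K), N.Normal ∧ N.FiniteIndex ∧ ¬ IsCongruence K N := by
  rcases hd with rfl | rfl
  · obtain ⟨f⟩ := BianchiPresentation.nonempty_ringOfIntegers_equiv (b := 0) (θ := α) (.inl rfl) hK2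
      (by simpa [pow_two] using hα)
    obtain ⟨ψ, hψ, hn⟩ := BianchiPresentation.exists_hom_gauss
    exact BianchiPresentation.exists_not_isCongruence f ψ hψ hn
  · obtain ⟨f⟩ := BianchiPresentation.nonempty_ringOfIntegers_equiv (b := 1) (θ := (1 + α) / 2)
      (.inr rfl) hK2 (by
        simp only [neg_smul, one_smul]
        push_cast at hα
        linear_combination hα / 4)
    obtain ⟨ψ, hψ, hn⟩ := BianchiPresentation.exists_hom_eisenstein
    exact BianchiPresentation.exists_not_isCongruence f ψ hψ hn
end

section
/- Let d < 0 be a squarefree integer, O_d the ring of integers of ℚ(√d), R = O_d/2O_d, G = SL(2,R), and G² = ⟨x² : x ∈ G⟩ the subgroup of G generated by squares. If the ideal 2O_d is prime, then G = G². If 2O_d is not prime, then the quotient G/G² is isomorphic to ℤ/2 × ℤ/2. -/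
open NumberField Matrix

/-- The subgroup of a group `G` generated by all squares `x²`, `x ∈ G`. -/
def sqSubgroup (G : Type*) [Group G] : Subgroup G :=
  Subgroup.closure {x : G | ∃ y : G, x = y ^ 2}

instance sqSubgroup_normal (G : Type*) [Group G] : (sqSubgroup G).Normal := by
  constructor
  intro n hn g
  have h : Subgroup.map (MulAut.conj g).toMonoidHom (sqSubgroup G) ≤ sqSubgroup G := by
    rw [sqSubgroup, MonoidHom.map_closure]
    apply Subgroup.closure_mono
    rintro _ ⟨_, ⟨y, rfl⟩, rfl⟩
    exact ⟨MulAut.conj g y, by simp [map_pow]⟩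
  simpa using h (Subgroup.mem_map_of_mem _ hn)

section ElementaryGeneration

variable {R : Type*} [CommRing R]

namespace SL2

/-- The element of `SL₂` with rows `(a, b)` and `(c, d)`. -/
def ofEntries (a b c d : R) (h : a * d - b * c = 1) : SpecialLinearGroup (Fin 2) R :=
  ⟨!![a, b; c, d], by rw [det_fin_two_of, h]⟩

section Entries

variable (a b c d : R) (h : a * d - b * c = 1)

@[simp] theorem ofEntries_zero_zero : ofEntries a b c d h 0 0 = a := rfl

@[simp] theorem ofEntries_zero_one : ofEntries a b c d h 0 1 = b := rfl

@[simp] theorem ofEntries_one_zero : ofEntries a b c d h 1 0 = c := rfl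

@[simp] theorem ofEntries_one_one : ofEntries a b c d h 1 1 = d := rfl

end Entries

theorem mul_apply (M N : SpecialLinearGroup (Fin 2) R) (i j : Fin 2) :
    (M * N) i j = M i 0 * N 0 j + M i 1 * N 1 j :=
  Matrix.mul_apply.trans (Fin.sum_univ_two _)

theorem det_eq_one (M : SpecialLinearGroup (Fin 2) R) :
    M 0 0 * M 1 1 - M 0 1 * M 1 0 = 1 := by
  rw [← det_fin_two]
  exact M.2

theorem ext_entries {M N : SpecialLinearGroup (Fin 2) R} (h₀₀ : M 0 0 = N 0 0)
    (h₀₁ : M 0 1 = N 0 1) (h₁₀ : M 1 0 = N 1 0) (h₁₁ : M 1 1 = N 1 1) : M = N := by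
  ext i j
  fin_cases i <;> fin_cases j <;> assumption

end SL2

/-- The upper unitriangular matrices, as a homomorphism from the additive group of the ring. -/
def upperUnipotent (R : Type*) [CommRing R] :
    Multiplicative R →* SpecialLinearGroup (Fin 2) R where
  toFun r := SL2.ofEntries 1 r.toAdd 0 1 (by simp)
  map_one' := by apply SL2.ext_entries <;> simp
  map_mul' r s := by apply SL2.ext_entries <;> simp [SL2.mul_apply, add_comm]

theorem upperUnipotent_apply (r : Multiplicative R) :
    upperUnipotent R r = SL2.ofEntries 1 r.toAdd 0 1 (by simp) := rfl

theorem map_upperUnipotent {S : Type*} [CommRing S] (f : R →+* S) (r : R) :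
    SpecialLinearGroup.map f (upperUnipotent R (Multiplicative.ofAdd r)) =
      upperUnipotent S (Multiplicative.ofAdd (f r)) := by
  apply SL2.ext_entries <;> simp [upperUnipotent_apply]

/-- The composite of `upperUnipotent` with the projection modulo squares. -/
def unipotentModSquares (R : Type*) [CommRing R] :
    Multiplicative R →*
      SpecialLinearGroup (Fin 2) R ⧸ sqSubgroup (SpecialLinearGroup (Fin 2) R) :=
  (QuotientGroup.mk' _).comp (upperUnipotent R)

theorem sq_mem_sqSubgroup {G : Type*} [Group G] (x : G) : x ^ 2 ∈ sqSubgroup G :=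
  Subgroup.subset_closure ⟨x, rfl⟩

theorem commutator_mem_sqSubgroup {G : Type*} [Group G] (a b : G) :
    a * b * a⁻¹ * b⁻¹ ∈ sqSubgroup G := by
  have h : a * b * a⁻¹ * b⁻¹ = a ^ 2 * (a⁻¹ * b) ^ 2 * (b⁻¹) ^ 2 := by
    simp only [pow_two]
    group
  rw [h]
  exact mul_mem (mul_mem (sq_mem_sqSubgroup _) (sq_mem_sqSubgroup _)) (sq_mem_sqSubgroup _)

theorem sqSubgroup_le_ker {G : Type*} [Group G] (χ : G →* Multiplicative (ZMod 2)) :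
    sqSubgroup G ≤ χ.ker := by
  rw [sqSubgroup, Subgroup.closure_le]
  rintro _ ⟨y, rfl⟩
  have h : ∀ z : Multiplicative (ZMod 2), z ^ 2 = 1 := by decide
  simp [MonoidHom.mem_ker, h]

/-- If `(a, c)` unimodular implies that some `c + s * a` is a unit, then a subgroup of `SL₂`
containing all unitriangular matrices is everything. -/
theorem eq_top_of_unipotent_mem
    (hR : ∀ a c : R, IsCoprime a c → ∃ s, IsUnit (c + s * a))
    (H : Subgroup (SpecialLinearGroup (Fin 2) R))
    (hU : ∀ r : R, SL2.ofEntries 1 r 0 1 (by simp) ∈ H)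
    (hL : ∀ r : R, SL2.ofEntries 1 0 r 1 (by simp) ∈ H) :
    H = ⊤ := by
  have unit_case : ∀ M : SpecialLinearGroup (Fin 2) R, IsUnit (M 1 0) → M ∈ H := by
    intro M hM
    obtain ⟨v, hv⟩ := hM.exists_right_inv
    have hdet := SL2.det_eq_one M
    have hM' : M = SL2.ofEntries 1 ((M 0 0 - 1) * v) 0 1 (by simp) *
        SL2.ofEntries 1 0 (M 1 0) 1 (by simp) *
        SL2.ofEntries 1 ((M 1 1 - 1) * v) 0 1 (by simp) := by
      apply SL2.ext_entries <;> simp [SL2.mul_apply]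
      · linear_combination (1 - M 0 0) * hv
      · linear_combination -v * hdet - (M 0 1 + (M 0 0 - 1) * (M 1 1 - 1) * v) * hv
      · linear_combination (1 - M 1 1) * hv
    rw [hM']
    exact mul_mem (mul_mem (hU _) (hL _)) (hU _)
  rw [eq_top_iff]
  intro M _
  have hdet := SL2.det_eq_one M
  obtain ⟨s, hs⟩ := hR (M 0 0) (M 1 0) ⟨M 1 1, -M 0 1, by linear_combination hdet⟩
  refine (H.mul_mem_cancel_left (hL s)).mp (unit_case _ ?_)
  simpa [SL2.mul_apply, add_comm] using hs

theorem unipotentModSquares_surjective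
    (hR : ∀ a c : R, IsCoprime a c → ∃ s, IsUnit (c + s * a)) :
    Function.Surjective (unipotentModSquares R) := by
  have hU : ∀ r : R, SL2.ofEntries 1 r 0 1 (by simp) ∈
      (unipotentModSquares R).range.comap (QuotientGroup.mk' _) :=
    fun r ↦ ⟨Multiplicative.ofAdd r, rfl⟩
  have htop := eq_top_of_unipotent_mem hR
    ((unipotentModSquares R).range.comap (QuotientGroup.mk' _)) hU (fun r ↦ by
      have hsq : sqSubgroup (SpecialLinearGroup (Fin 2) R) ≤
          (unipotentModSquares R).range.comap (QuotientGroup.mk' _) := fun x hx ↦ by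
        rw [Subgroup.mem_comap, QuotientGroup.mk'_apply, (QuotientGroup.eq_one_iff x).mpr hx]
        exact one_mem _
      let w : SpecialLinearGroup (Fin 2) R := SL2.ofEntries 0 1 (-1) 0 (by simp)
      let u : SpecialLinearGroup (Fin 2) R := SL2.ofEntries 1 (-r) 0 1 (by simp)
      have hw : SL2.ofEntries 1 0 r 1 (by simp) =
          w * u * w⁻¹ * u⁻¹ * u := by
        rw [inv_mul_cancel_right]
        refine eq_mul_inv_of_mul_eq ?_
        apply SL2.ext_entries <;> simp [w, u, SL2.mul_apply]
      rw [hw]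
      exact mul_mem (hsq (commutator_mem_sqSubgroup w u)) (hU _))
  intro q
  obtain ⟨M, rfl⟩ := QuotientGroup.mk'_surjective _ q
  exact (htop ▸ Subgroup.mem_top M :
    M ∈ (unipotentModSquares R).range.comap (QuotientGroup.mk' _))

theorem unipotentModSquares_injective
    (h : ∀ r : R, r ≠ 0 → ∃ χ : SpecialLinearGroup (Fin 2) R →* Multiplicative (ZMod 2),
      χ (upperUnipotent R (Multiplicative.ofAdd r)) ≠ 1) :
    Function.Injective (unipotentModSquares R) := by
  rw [injective_iff_map_eq_one]
  intro r hr
  by_contra hne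
  obtain ⟨χ, hχ⟩ := h r.toAdd hne
  exact hχ (sqSubgroup_le_ker χ ((QuotientGroup.eq_one_iff _).mp hr))

end ElementaryGeneration

/-- A field with an element whose square is not `0` or `1` has `SL₂` generated by squares. -/
theorem sqSubgroup_sl2_eq_top {F : Type*} [Field F] (t : F) (ht : t ≠ 0) (ht2 : t ^ 2 ≠ 1) :
    sqSubgroup (SpecialLinearGroup (Fin 2) F) = ⊤ := by
  have hR : ∀ a c : F, IsCoprime a c → ∃ s, IsUnit (c + s * a) := by
    rintro a c ⟨x, y, h⟩
    by_cases hc : c = 0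
    · refine ⟨1, isUnit_iff_ne_zero.mpr fun h0 ↦ ?_⟩
      simp_all
    · exact ⟨0, by simpa using hc⟩
  have hu : ∀ r : F, upperUnipotent F (Multiplicative.ofAdd r) ∈ sqSubgroup _ := by
    intro r
    let D : SpecialLinearGroup (Fin 2) F := SL2.ofEntries t 0 0 t⁻¹ (by simp [ht])
    let u := upperUnipotent F (Multiplicative.ofAdd (r / (t ^ 2 - 1)))
    have h : upperUnipotent F (Multiplicative.ofAdd r) = D * u * D⁻¹ * u⁻¹ := by
      have ht3 : t ^ 2 - 1 ≠ 0 := sub_ne_zero.mpr ht2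
      refine eq_mul_inv_of_mul_eq (eq_mul_inv_of_mul_eq ?_)
      apply SL2.ext_entries <;> simp [D, u, upperUnipotent_apply, SL2.mul_apply]
      field_simp
      ring
    rw [h]
    exact commutator_mem_sqSubgroup D u
  rw [eq_top_iff]
  intro M _
  obtain ⟨r, hr⟩ := unipotentModSquares_surjective hR (QuotientGroup.mk' _ M)
  rw [← QuotientGroup.eq_one_iff]
  exact hr.symm.trans ((QuotientGroup.eq_one_iff _).mpr (hu r.toAdd))

/-- The sign character of `SL₂(𝔽₂) ≅ S₃`. -/
def signSL2 : SpecialLinearGroup (Fin 2) (ZMod 2) →* Multiplicative (ZMod 2) where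
  toFun M := Multiplicative.ofAdd (M 0 0 * M 0 1 + M 0 1 * M 1 0 + M 1 0 * M 1 1)
  map_one' := by simp
  map_mul' M N := by
    have key : ∀ a b c d : ZMod 2, a * d - b * c = 1 → ∀ a' b' c' d' : ZMod 2,
        a' * d' - b' * c' = 1 →
        (a * a' + b * c') * (a * b' + b * d') + (a * b' + b * d') * (c * a' + d * c') +
          (c * a' + d * c') * (c * b' + d * d') =
        a * b + b * c + c * d + (a' * b' + b' * c' + c' * d') := by decide
    simp only [SL2.mul_apply, ← ofAdd_add]
    exact congrArg _ (key _ _ _ _ (SL2.det_eq_one M) _ _ _ _ (SL2.det_eq_one N))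

theorem signSL2_upperUnipotent (r : ZMod 2) :
    signSL2 (upperUnipotent _ (Multiplicative.ofAdd r)) = Multiplicative.ofAdd r :=
  congrArg Multiplicative.ofAdd (by simp [upperUnipotent_apply])

/-- The character of `SL₂(𝔽₂[ε])` sending `A (1 + ε N)`, with `A` in `SL₂(𝔽₂)`, to the sum of the
entries of the first row and the lower left entry of `N`. -/
def tangentSL2 : SpecialLinearGroup (Fin 2) (DualNumber (ZMod 2)) →* Multiplicative (ZMod 2) where
  toFun M := Multiplicative.ofAdd
    ((M 1 1).fst * (M 0 0).snd + (M 0 1).fst * (M 1 0).snd +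
      ((M 1 1).fst * (M 0 1).snd + (M 0 1).fst * (M 1 1).snd) +
      ((M 1 0).fst * (M 0 0).snd + (M 0 0).fst * (M 1 0).snd))
  map_one' := by simp
  map_mul' M N := by
    have key : ∀ a b c d : ZMod 2, a * d - b * c = 1 → ∀ a' b' c' d' : ZMod 2,
        a' * d' - b' * c' = 1 → ∀ x y z w : ZMod 2, a * w + x * d - (b * z + y * c) = 0 →
        ∀ x' y' z' w' : ZMod 2,
        (c * b' + d * d') * (a * x' + x * a' + (b * z' + y * c')) +
            (a * b' + b * d') * (c * x' + z * a' + (d * z' + w * c')) +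
            ((c * b' + d * d') * (a * y' + x * b' + (b * w' + y * d')) +
              (a * b' + b * d') * (c * y' + z * b' + (d * w' + w * d'))) +
            ((c * a' + d * c') * (a * x' + x * a' + (b * z' + y * c')) +
              (a * a' + b * c') * (c * x' + z * a' + (d * z' + w * c'))) =
          d * x + b * z + (d * y + b * w) + (c * x + a * z) +
          (d' * x' + b' * z' + (d' * y' + b' * w') + (c' * x' + a' * z')) := by
      have invariant : ∀ a' b' c' d' : ZMod 2, a' * d' - b' * c' = 1 → ∀ p q r : ZMod 2,
          d' * (p * a' + q * c') + b' * (r * a' + p * c') +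
            (d' * (p * b' + q * d') + b' * (r * b' + p * d')) +
            (c' * (p * a' + q * c') + a' * (r * a' + p * c')) = p + q + r := by decide
      intro a b c d h a' b' c' d' h' x y z w ht x' y' z' w'
      have inv := invariant a' b' c' d' h' (d * x + b * z) (d * y + b * w) (c * x + a * z)
      grind
    have hM := SL2.det_eq_one M
    have hN := SL2.det_eq_one N
    have hM0 := congrArg TrivSqZeroExt.fst hM
    have hM1 := congrArg TrivSqZeroExt.snd hM
    have hN0 := congrArg TrivSqZeroExt.fst hN
    simp only [TrivSqZeroExt.fst_sub, TrivSqZeroExt.snd_sub, TrivSqZeroExt.fst_mul,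
      DualNumber.snd_mul, TrivSqZeroExt.fst_one, TrivSqZeroExt.snd_one] at hM0 hM1 hN0
    simp only [SL2.mul_apply, ← ofAdd_add, TrivSqZeroExt.fst_add, TrivSqZeroExt.snd_add,
      TrivSqZeroExt.fst_mul, DualNumber.snd_mul]
    exact congrArg _ (key _ _ _ _ hM0 _ _ _ _ hN0 _ _ _ _ hM1 _ _ _ _)

theorem tangentSL2_upperUnipotent (r : DualNumber (ZMod 2)) :
    tangentSL2 (upperUnipotent _ (Multiplicative.ofAdd r)) = Multiplicative.ofAdd r.snd :=
  congrArg Multiplicative.ofAdd (by simp [upperUnipotent_apply])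

theorem exists_character_of_ringHom {R : Type*} [CommRing R] (f : R →+* ZMod 2) (r : R)
    (hr : f r ≠ 0) : ∃ χ : SpecialLinearGroup (Fin 2) R →* Multiplicative (ZMod 2),
      χ (upperUnipotent _ (Multiplicative.ofAdd r)) ≠ 1 := by
  refine ⟨signSL2.comp (SpecialLinearGroup.map f), ?_⟩
  rw [MonoidHom.comp_apply, map_upperUnipotent, signSL2_upperUnipotent]
  exact hr

theorem exists_character_dualNumber (r : DualNumber (ZMod 2)) (hr : r ≠ 0) :
    ∃ χ : SpecialLinearGroup (Fin 2) (DualNumber (ZMod 2)) →* Multiplicative (ZMod 2),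
      χ (upperUnipotent _ (Multiplicative.ofAdd r)) ≠ 1 := by
  by_cases h : r.fst = 0
  · refine ⟨tangentSL2, fun h1 ↦ hr (TrivSqZeroExt.ext h ?_)⟩
    rw [tangentSL2_upperUnipotent] at h1
    exact h1
  · exact exists_character_of_ringHom
      (TrivSqZeroExt.fstHom (ZMod 2) (ZMod 2) (ZMod 2)).toRingHom r h

theorem exists_character_prod (r : ZMod 2 × ZMod 2) (hr : r ≠ 0) :
    ∃ χ : SpecialLinearGroup (Fin 2) (ZMod 2 × ZMod 2) →* Multiplicative (ZMod 2),
      χ (upperUnipotent _ (Multiplicative.ofAdd r)) ≠ 1 := by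
  by_cases h : r.1 = 0
  · exact exists_character_of_ringHom (RingHom.snd _ _) r fun h2 ↦ hr (Prod.ext h h2)
  · exact exists_character_of_ringHom (RingHom.fst _ _) r h

theorem exists_isUnit_add_mul_prod (a c : ZMod 2 × ZMod 2) (h : IsCoprime a c) :
    ∃ s, IsUnit (c + s * a) := by
  have key : ∀ a c x y : ZMod 2 × ZMod 2, x * a + y * c = 1 → ∃ s, c + s * a = 1 := by decide
  obtain ⟨x, y, h⟩ := h
  obtain ⟨s, hs⟩ := key a c x y h
  exact ⟨s, hs ▸ isUnit_one⟩

theorem exists_isUnit_add_mul_dualNumber (a c : DualNumber (ZMod 2)) (h : IsCoprime a c) :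
    ∃ s, IsUnit (c + s * a) := by
  by_cases hc : IsUnit c
  · exact ⟨0, by simpa using hc⟩
  refine ⟨1, ?_⟩
  rw [one_mul, add_comm]
  obtain ⟨x, y, h⟩ := h
  have h0 := congrArg TrivSqZeroExt.fst h
  rw [TrivSqZeroExt.isUnit_iff_isUnit_fst, isUnit_iff_ne_zero, not_not] at hc
  rw [TrivSqZeroExt.isUnit_iff_isUnit_fst, isUnit_iff_ne_zero]
  intro h1
  rw [TrivSqZeroExt.fst_add, hc, add_zero] at h1
  rw [TrivSqZeroExt.fst_add, TrivSqZeroExt.fst_mul, TrivSqZeroExt.fst_mul, h1, hc] at h0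
  simp at h0

/-- If `S` has additive group `(ℤ/2)²` and stable rank one, and characters detect its unitriangular
matrices, then for any ring isomorphic to `S` the group `SL₂` modulo squares is `(ℤ/2)²`. -/
theorem nonempty_quotient_sqSubgroup_mulEquiv {R S : Type*} [CommRing R] [CommRing S]
    (e : S ≃+* R) (f : S ≃+ ZMod 2 × ZMod 2)
    (hS : ∀ a c : S, IsCoprime a c → ∃ s, IsUnit (c + s * a))
    (h : ∀ r : S, r ≠ 0 → ∃ χ : SpecialLinearGroup (Fin 2) S →* Multiplicative (ZMod 2),
      χ (upperUnipotent S (Multiplicative.ofAdd r)) ≠ 1) :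
    Nonempty ((SpecialLinearGroup (Fin 2) R ⧸ sqSubgroup (SpecialLinearGroup (Fin 2) R)) ≃*
      (Multiplicative (ZMod 2) × Multiplicative (ZMod 2))) := by
  have hR : ∀ a c : R, IsCoprime a c → ∃ s, IsUnit (c + s * a) := by
    intro a c hac
    obtain ⟨s, hs⟩ := hS (e.symm a) (e.symm c) (hac.map e.symm.toRingHom)
    exact ⟨e s, by simpa using hs.map e⟩
  have hχ : ∀ r : R, r ≠ 0 → ∃ χ : SpecialLinearGroup (Fin 2) R →* Multiplicative (ZMod 2),
      χ (upperUnipotent R (Multiplicative.ofAdd r)) ≠ 1 := by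
    intro r hr
    obtain ⟨χ, hχ⟩ := h (e.symm r) (by simpa using hr)
    refine ⟨χ.comp (SpecialLinearGroup.map e.symm.toRingHom), ?_⟩
    rw [MonoidHom.comp_apply, map_upperUnipotent]
    exact hχ
  exact ⟨(MulEquiv.ofBijective _ ⟨unipotentModSquares_injective hχ,
    unipotentModSquares_surjective hR⟩).symm.trans
    ((e.symm.toAddEquiv.trans f).toMultiplicative.trans (MulEquiv.prodMultiplicative _ _))⟩

/-- A commutative ring of characteristic two with four elements which is not a domain is the ring
of dual numbers over `𝔽₂` or the product `𝔽₂ × 𝔽₂`. -/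
theorem ringEquiv_of_card_eq_four {R : Type*} [CommRing R] [Nontrivial R] (h2 : (2 : R) = 0)
    (hcard : Nat.card R = 4) (hdom : ¬ IsDomain R) :
    Nonempty (DualNumber (ZMod 2) ≃+* R) ∨ Nonempty (ZMod 2 × ZMod 2 ≃+* R) := by
  have : CharP R 2 := CharTwo.of_one_ne_zero_of_two_eq_zero one_ne_zero h2
  let _ : Algebra (ZMod 2) R := ZMod.algebra R 2
  have : Finite R := Nat.finite_of_card_ne_zero (by omega)
  have hz : ∀ z : ZMod 2, z = 0 ∨ z = 1 := by decide
  obtain ⟨t, ht0, htu⟩ : ∃ t : R, t ≠ 0 ∧ ¬ IsUnit t := by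
    by_contra! hcon
    exact hdom (IsField.isDomain ⟨exists_pair_ne R, mul_comm,
      fun {a} ha ↦ (hcon a ha).exists_right_inv⟩)
  have ht1 : t ≠ 1 := fun h ↦ htu (h ▸ isUnit_one)
  have ht1' : 1 + t ≠ 0 := fun h ↦ ht1 (by linear_combination h - h2)
  have hinj : Function.Injective
      (fun p : ZMod 2 × ZMod 2 ↦ algebraMap (ZMod 2) R p.1 + algebraMap (ZMod 2) R p.2 * t) := by
    have : Function.Injective ((algebraMap (ZMod 2) R).toAddMonoidHom.coprod
        ((AddMonoidHom.mulRight t).comp (algebraMap (ZMod 2) R).toAddMonoidHom)) := by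
      rw [injective_iff_map_eq_zero]
      rintro ⟨x, y⟩ hxy
      rcases hz x with rfl | rfl <;> rcases hz y with rfl | rfl <;> simp_all
    exact this
  have hsurj := ((Nat.bijective_iff_injective_and_card _).mpr ⟨hinj, by simp [hcard]⟩).2
  obtain ⟨⟨x, y⟩, hxy⟩ := hsurj (t ^ 2)
  have hsq : t ^ 2 = 0 ∨ t ^ 2 = t := by
    rcases hz x with rfl | rfl
    · rcases hz y with rfl | rfl
      · left
        simpa using hxy.symm
      · right
        simpa using hxy.symm
    · exfalso
      refine htu (IsUnit.of_mul_eq_one (t - algebraMap (ZMod 2) R y) ?_)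
      simp only [map_one] at hxy
      linear_combination -hxy
  rcases hsq with hsq | hsq
  · left
    let φ : DualNumber (ZMod 2) →ₐ[ZMod 2] R :=
      DualNumber.lift ⟨(Algebra.ofId (ZMod 2) R, t), by rw [← pow_two, hsq],
        fun _ ↦ Commute.all _ _⟩
    refine ⟨RingEquiv.ofBijective φ ((Nat.bijective_iff_injective_and_card _).mpr ⟨?_, ?_⟩)⟩
    · intro p q hpq
      simp only [φ, DualNumber.lift_apply_apply, Algebra.ofId_apply] at hpq
      exact hinj hpq
    · rw [hcard]
      exact (Nat.card_prod (ZMod 2) (ZMod 2)).trans (by simp)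
  · right
    let φ : ZMod 2 × ZMod 2 →+* R :=
      { toFun p := algebraMap (ZMod 2) R p.1 * t + algebraMap (ZMod 2) R p.2 * (1 - t)
        map_one' := by simp
        map_zero' := by simp
        map_add' p q := by
          simp only [Prod.fst_add, Prod.snd_add, map_add]
          ring
        map_mul' p q := by
          simp only [Prod.fst_mul, Prod.snd_mul, map_mul]
          linear_combination (-(algebraMap (ZMod 2) R p.1 - algebraMap (ZMod 2) R p.2) *
            (algebraMap (ZMod 2) R q.1 - algebraMap (ZMod 2) R q.2)) * hsq }
    refine ⟨RingEquiv.ofBijective φ ((Nat.bijective_iff_injective_and_card _).mpr ⟨?_, ?_⟩)⟩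
    · rw [injective_iff_map_eq_zero]
      rintro ⟨x, y⟩ hxy
      have : ((y, x - y) : ZMod 2 × ZMod 2) = (0, 0) := hinj (by
        simp only [map_sub, map_zero]
        change _ * t + _ * (1 - t) = (0 : R) at hxy
        linear_combination hxy)
      simp only [Prod.mk.injEq] at this
      ext
      · simpa [this.1] using this.2
      · exact this.1
    · rw [hcard]
      simp

theorem sqSubgroup_sl2_eq_top_of_card_eq_four {R : Type*} [CommRing R] [IsDomain R]
    (h2 : (2 : R) = 0) (hcard : Nat.card R = 4) :
    sqSubgroup (SpecialLinearGroup (Fin 2) R) = ⊤ := by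
  classical
  have : Finite R := Nat.finite_of_card_ne_zero (by omega)
  let _ : Field R := (Finite.isField_of_domain R).toField
  have := Fintype.ofFinite R
  obtain ⟨t, ht⟩ : ∃ t : R, t ∉ ({0, 1} : Finset R) := by
    by_contra! hcon
    have := Finset.card_le_card (fun t _ ↦ hcon t : Finset.univ ⊆ ({0, 1} : Finset R))
    rw [Finset.card_univ, ← Nat.card_eq_fintype_card, hcard] at this
    exact absurd (this.trans Finset.card_le_two) (by norm_num)
  simp only [Finset.mem_insert, Finset.mem_singleton, not_or] at ht
  refine sqSubgroup_sl2_eq_top t ht.1 fun h ↦ ht.2 ?_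
  refine sub_eq_zero.mp (pow_eq_zero_iff two_ne_zero |>.mp ?_)
  linear_combination h + (1 - t) * h2

theorem nonempty_mulEquiv_of_not_isDomain {R : Type*} [CommRing R] [Nontrivial R]
    (h2 : (2 : R) = 0) (hcard : Nat.card R = 4) (hdom : ¬ IsDomain R) :
    Nonempty ((SpecialLinearGroup (Fin 2) R ⧸ sqSubgroup (SpecialLinearGroup (Fin 2) R)) ≃*
      (Multiplicative (ZMod 2) × Multiplicative (ZMod 2))) := by
  rcases ringEquiv_of_card_eq_four h2 hcard hdom with ⟨⟨e⟩⟩ | ⟨⟨e⟩⟩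
  · exact nonempty_quotient_sqSubgroup_mulEquiv e (AddEquiv.refl _)
      exists_isUnit_add_mul_dualNumber exists_character_dualNumber
  · exact nonempty_quotient_sqSubgroup_mulEquiv e (AddEquiv.refl _)
      exists_isUnit_add_mul_prod exists_character_prod

theorem card_quotient_span_two (K : Type*) [Field K] [NumberField K]
    (hK2 : Module.finrank ℚ K = 2) : Nat.card (𝓞 K ⧸ Ideal.span {(2 : 𝓞 K)}) = 4 := by
  have h : Ideal.absNorm (Ideal.span {(2 : 𝓞 K)}) = 4 := by
    rw [Ideal.absNorm_span_singleton, show (2 : 𝓞 K) = algebraMap ℤ (𝓞 K) 2 by simp,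
      Algebra.norm_algebraMap, RingOfIntegers.rank, hK2]
    rfl
  rwa [Ideal.absNorm_apply] at h

/-- **Lemma 6.1.** Let `d < 0` be squarefree, `O_d` the ring of integers of `K = ℚ(√d)`,
`R = O_d/2O_d` and `G = SL(2, R)`, with `G²` the subgroup of `G` generated by squares.
If the ideal `2O_d` is prime then `G = G²`; if `2O_d` is not prime then
`G/G² ≅ ℤ/2 × ℤ/2`. -/
theorem sl2_mod_two_squares
    (K : Type*) [Field K] [NumberField K]
    (d : ℤ) (hd : d < 0) (hdsf : Squarefree d)
    (hK2 : Module.finrank ℚ K = 2) (α : K) (hα : α ^ 2 = (d : K)) :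
    ((Ideal.span {(2 : 𝓞 K)}).IsPrime →
        sqSubgroup (Matrix.SpecialLinearGroup (Fin 2) ((𝓞 K) ⧸ Ideal.span {(2 : 𝓞 K)})) = ⊤) ∧
      (¬ (Ideal.span {(2 : 𝓞 K)}).IsPrime →
        Nonempty
          ((Matrix.SpecialLinearGroup (Fin 2) ((𝓞 K) ⧸ Ideal.span {(2 : 𝓞 K)}) ⧸
              sqSubgroup (Matrix.SpecialLinearGroup (Fin 2) ((𝓞 K) ⧸ Ideal.span {(2 : 𝓞 K)}))) ≃*
            (Multiplicative (ZMod 2) × Multiplicative (ZMod 2)))) := by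
  have hcard := card_quotient_span_two K hK2
  have h2 : (2 : 𝓞 K ⧸ Ideal.span {(2 : 𝓞 K)}) = 0 :=
    Ideal.Quotient.eq_zero_iff_mem.mpr (Ideal.mem_span_singleton_self 2)
  have hfin : Finite (𝓞 K ⧸ Ideal.span {(2 : 𝓞 K)}) := Nat.finite_of_card_ne_zero (by omega)
  have : Nontrivial (𝓞 K ⧸ Ideal.span {(2 : 𝓞 K)}) :=
    Finite.one_lt_card_iff_nontrivial.mp (by omega)
  rw [← Ideal.Quotient.isDomain_iff_prime]
  exact ⟨fun _ ↦ sqSubgroup_sl2_eq_top_of_card_eq_four h2 hcard, fun hdom ↦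
    nonempty_mulEquiv_of_not_isDomain h2 hcard hdom⟩
end
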